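/- arXiv:2504.07663 — 3 statements merged into one kernel-verified Lean document; each statement's English description precedes it below -/
import Mathlib

section
/- For every k ∈ ℕ, the minimum of obj(x, y) over all (x, y) ∈ P(k) equals the minimum of cost(A) over all sets A ⊆ Fin n with |A| ≤ k. In particular, the linear-programming relaxation P(k) always has an optimal solution that is integral. -/
open Finset

noncomputable section

/-- Cost of the assignment `π` (customer `j` is assigned to supplier `π j`)
when the suppliers in `A` are upgraded. -/
def assignCost {n : ℕ} (b c d : Fin n → ℝ) (A : Finset (Fin n))
    (π : Equiv.Perm (Fin n)) : ℝ :=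
  ∑ j, (if π j ∈ A then b (π j) else c (π j)) * d j

/-- `cost A` : minimum assignment cost when upgrading the suppliers in `A`. -/
def cost {n : ℕ} (b c d : Fin n → ℝ) (A : Finset (Fin n)) : ℝ :=
  Finset.univ.inf' Finset.univ_nonempty (assignCost b c d A)

/-- The LP feasible region `P(k)`. -/
def Pk (n k : ℕ) : Set ((Fin n → Fin n → ℝ) × (Fin n → Fin n → ℝ)) :=
  {p | (∀ i j, 0 ≤ p.1 i j) ∧ (∀ i j, 0 ≤ p.2 i j) ∧
    (∀ j, ∑ i, (p.1 i j + p.2 i j) = 1) ∧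
    (∀ i, ∑ j, (p.1 i j + p.2 i j) = 1) ∧
    (∑ i, ∑ j, p.1 i j) ≤ (k : ℝ)}

/-- The LP objective. -/
def obj {n : ℕ} (b c d : Fin n → ℝ)
    (p : (Fin n → Fin n → ℝ) × (Fin n → Fin n → ℝ)) : ℝ :=
  ∑ i, ∑ j, (b i * p.1 i j + c i * p.2 i j) * d j

/-- A point is integral if all of its entries lie in `{0, 1}`. -/
def Integral {n : ℕ} (p : (Fin n → Fin n → ℝ) × (Fin n → Fin n → ℝ)) : Prop :=
  (∀ i j, p.1 i j = 0 ∨ p.1 i j = 1) ∧ (∀ i j, p.2 i j = 0 ∨ p.2 i j = 1)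

/-- `f_{A,B}(k)`. -/
def fpair {n : ℕ} (b c d : Fin n → ℝ) (k : ℕ) (A B : Finset (Fin n)) : ℝ :=
  (((B.card : ℝ) - k) * cost b c d A + ((k : ℝ) - A.card) * cost b c d B) /
    ((B.card : ℝ) - A.card)

/-- `(A, B)` is an optimal pair. -/
def OptimalPair {n : ℕ} (b c d : Fin n → ℝ) (k : ℕ) (A B : Finset (Fin n)) : Prop :=
  A.card < k ∧ k < B.card ∧ IsLeast (obj b c d '' Pk n k) (fpair b c d k A B)

/-- `X` is simple: some optimal assignment for upgrading `X` assigns every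
upgraded supplier to a customer with positive demand. -/
def SimpleSet {n : ℕ} (b c d : Fin n → ℝ) (X : Finset (Fin n)) : Prop :=
  ∃ π : Equiv.Perm (Fin n), assignCost b c d X π = cost b c d X ∧
    ∀ j, π j ∈ X → 0 < d j

/-- `(A, B)` is clean. -/
def Clean {n : ℕ} (b c : Fin n → ℝ) (A B : Finset (Fin n)) : Prop :=
  ∀ i ∈ symmDiff A B, ∀ i' ∈ symmDiff A B, ¬ (b i < b i' ∧ c i' < c i)

/-- `(A', B')` is a redistribution of `(A, B)` : the elements of `A ∆ B` are
enumerated `e 0, e 1, …` with `b` and `c` both nondecreasing along the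
enumeration, the elements with odd (0-based) index go to `A'` and those with
even (0-based) index go to `B'` (on top of `A ∩ B`). -/
def Redistribution {n : ℕ} (b c : Fin n → ℝ) (A B A' B' : Finset (Fin n)) : Prop :=
  ∃ (ℓ : ℕ) (e : Fin ℓ → Fin n), Function.Injective e ∧
    Finset.image e Finset.univ = symmDiff A B ∧
    Monotone (b ∘ e) ∧ Monotone (c ∘ e) ∧
    A' = (A ∩ B) ∪
      Finset.image e ((Finset.univ : Finset (Fin ℓ)).filter (fun s => (s : ℕ) % 2 = 1)) ∧
    B' = (A ∩ B) ∪
      Finset.image e ((Finset.univ : Finset (Fin ℓ)).filter (fun s => (s : ℕ) % 2 = 0))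

/-- The 0/1 point of the LP corresponding to assignment `π` with upgraded set `A`. -/
def chi {n : ℕ} (π : Equiv.Perm (Fin n)) (A : Finset (Fin n)) :
    (Fin n → Fin n → ℝ) × (Fin n → Fin n → ℝ) :=
  (fun i j => if π j = i ∧ i ∈ A then 1 else 0,
   fun i j => if π j = i ∧ i ∉ A then 1 else 0)

/-- `hval k'` : minimum of `cost X` over all `X` of cardinality `k'`. -/
def hval {n : ℕ} (b c d : Fin n → ℝ) (k' : ℕ) : ℝ :=
  sInf {v | ∃ X : Finset (Fin n), X.card = k' ∧ cost b c d X = v}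

end

/-- Every finite set of nonnegative reals has a layer-cake decomposition: its elements are the
cumulative sums of a single nonnegative weight. -/
theorem exists_layer_weights (T : Finset ℝ) (hT : ∀ s ∈ T, 0 ≤ s) :
    ∃ g : ℝ → ℝ, (∀ τ, 0 ≤ g τ) ∧ (∀ s ∈ T, s = ∑ τ ∈ T, if τ ≤ s then g τ else 0) ∧
      ∀ M, 0 ≤ M → (∀ s ∈ T, s ≤ M) → ∑ τ ∈ T, g τ ≤ M := by
  induction T using Finset.induction_on_max with
  | empty => exact ⟨0, by simp, by simp, by simp⟩
  | insert m S hm ih =>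
    obtain ⟨g, hg, hsum, hbound⟩ := ih fun s hs => hT s (Finset.mem_insert_of_mem hs)
    have hm0 : 0 ≤ m := hT m (Finset.mem_insert_self _ _)
    have hmS : m ∉ S := fun h => (hm m h).false
    have hle : ∑ τ ∈ S, g τ ≤ m := hbound m hm0 fun s hs => (hm s hs).le
    have hupd : ∀ τ ∈ S, Function.update g m (m - ∑ τ ∈ S, g τ) τ = g τ := fun τ hτ =>
      Function.update_of_ne (ne_of_mem_of_not_mem hτ hmS) _ _
    refine ⟨Function.update g m (m - ∑ τ ∈ S, g τ), fun τ => ?_, fun s hs => ?_, fun M _ hM => ?_⟩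
    · by_cases h : τ = m
      · subst h; simpa using hle
      · simpa [Function.update_of_ne h] using hg τ
    · rw [Finset.sum_insert hmS]
      rcases Finset.mem_insert.1 hs with rfl | hs
      · have : ∑ τ ∈ S, (if τ ≤ s then Function.update g s (s - ∑ τ ∈ S, g τ) τ else 0)
            = ∑ τ ∈ S, g τ :=
          Finset.sum_congr rfl fun τ hτ => by rw [if_pos (hm τ hτ).le, hupd τ hτ]
        rw [this]; simp
      · rw [if_neg (hm s hs).not_ge, zero_add]
        refine (hsum s hs).trans (Finset.sum_congr rfl fun τ hτ => ?_)
        rw [hupd τ hτ]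
    · rw [Finset.sum_insert hmS, Finset.sum_congr rfl hupd]
      simpa using hM m (Finset.mem_insert_self _ _)

theorem integral_floor_add (t : ℝ) : ∫ u in (0 : ℝ)..1, (⌊t + u⌋ : ℝ) = t := by
  have hmono : Monotone fun u : ℝ => (⌊t + u⌋ : ℝ) := fun u v h =>
    Int.cast_mono (Int.floor_mono (by linarith))
  have h0 := Int.fract_nonneg t
  have h1 := Int.fract_lt_one t
  have ht := Int.self_sub_floor t
  rw [← intervalIntegral.integral_add_adjacent_intervals
    (hmono.intervalIntegrable (a := 0) (b := 1 - Int.fract t)) hmono.intervalIntegrable]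
  have hleft : ∫ u in (0 : ℝ)..(1 - Int.fract t), (⌊t + u⌋ : ℝ)
      = ∫ _u in (0 : ℝ)..(1 - Int.fract t), (⌊t⌋ : ℝ) := by
    refine intervalIntegral.integral_congr_Ioo_of_le (by linarith) fun u hu => ?_
    have : ⌊t + u⌋ = ⌊t⌋ := Int.floor_eq_iff.2 ⟨by linarith [hu.1], by linarith [hu.2]⟩
    simp [this]
  have hright : ∫ u in (1 - Int.fract t)..1, (⌊t + u⌋ : ℝ)
      = ∫ _u in (1 - Int.fract t)..1, ((⌊t⌋ : ℝ) + 1) := by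
    refine intervalIntegral.integral_congr_Ioo_of_le (by linarith) fun u hu => ?_
    have : ⌊t + u⌋ = ⌊t⌋ + 1 :=
      Int.floor_eq_iff.2 ⟨by push_cast; linarith [hu.1], by push_cast; linarith [hu.2]⟩
    simp [this]
  rw [hleft, hright]
  simp only [intervalIntegral.integral_const, smul_eq_mul]
  linarith

/-- Averaging over a common random shift: some shift makes a linear combination of differences of
floors at most the same combination of the unrounded differences. -/
theorem exists_shift_floor_le {ι : Type*} [Fintype ι] (w s t : ι → ℝ) :
    ∃ u : ℝ, ∑ i, w i * ((⌊s i + u⌋ : ℝ) - ⌊t i + u⌋) ≤ ∑ i, w i * (s i - t i) := by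
  have hint : ∀ t : ℝ, IntervalIntegrable (fun u : ℝ => (⌊t + u⌋ : ℝ))
      MeasureTheory.volume 0 1 := fun t =>
    Monotone.intervalIntegrable fun u v h => Int.cast_mono (Int.floor_mono (by linarith))
  have hterm : ∀ i, IntervalIntegrable (fun u : ℝ => w i * ((⌊s i + u⌋ : ℝ) - ⌊t i + u⌋))
      MeasureTheory.volume 0 1 := fun i => ((hint _).sub (hint _)).const_mul _
  have hval : ∫ u in (0 : ℝ)..1, ∑ i, w i * ((⌊s i + u⌋ : ℝ) - ⌊t i + u⌋)
      = ∑ i, w i * (s i - t i) := by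
    rw [intervalIntegral.integral_finsetSum fun i _ => hterm i]
    refine Finset.sum_congr rfl fun i _ => ?_
    rw [intervalIntegral.integral_const_mul, intervalIntegral.integral_sub (hint _) (hint _),
      integral_floor_add, integral_floor_add]
  by_contra! hlt
  have hsum : IntervalIntegrable (fun u : ℝ => ∑ i, w i * ((⌊s i + u⌋ : ℝ) - ⌊t i + u⌋))
      MeasureTheory.volume 0 1 := by
    have h := IntervalIntegrable.sum Finset.univ fun i _ => hterm i
    rwa [Finset.sum_fn] at h
  have hpos := intervalIntegral.intervalIntegral_pos_of_pos
    (hsum.sub (intervalIntegrable_const (c := ∑ i, w i * (s i - t i))))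
    (fun u => sub_pos.2 (hlt u)) zero_lt_one
  rw [intervalIntegral.integral_sub hsum intervalIntegrable_const, hval] at hpos
  simp at hpos

/-- Telescoping of systematic sampling along a lower set of the `b`-order. -/
theorem sum_floor_sub_of_lower {ι : Type*} [DecidableEq ι] (b z : ι → ℝ) (I S : Finset ι)
    (hinj : Set.InjOn b I) (u : ℝ) (hSI : S ⊆ I)
    (hlow : ∀ i ∈ S, ∀ l ∈ I, b l < b i → l ∈ S) :
    ∑ i ∈ S, ((⌊(∑ l ∈ I with b l < b i, z l) + z i + u⌋ : ℝ)
        - ⌊(∑ l ∈ I with b l < b i, z l) + u⌋ - z i)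
      = Int.fract u - Int.fract (∑ i ∈ S, z i + u) := by
  induction S using Finset.induction_on_max_value b with
  | empty => simp
  | insert a S haS hmax ih =>
    have hS : (I.filter fun l => b l < b a) = S := by
      ext l
      rw [Finset.mem_filter]
      constructor
      · rintro ⟨hl, hlt⟩
        refine (Finset.mem_insert.1 (hlow a (Finset.mem_insert_self _ _) l hl hlt)).resolve_left ?_
        rintro rfl
        exact hlt.false
      · intro hl
        have hlI := hSI (Finset.mem_insert_of_mem hl)
        refine ⟨hlI, lt_of_le_of_ne (hmax l hl) fun h => haS ?_⟩
        rwa [← hinj hlI (hSI (Finset.mem_insert_self _ _)) h]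
    rw [Finset.sum_insert haS, Finset.sum_insert haS, hS,
      ih (fun x hx => hSI (Finset.mem_insert_of_mem hx)) fun i hi l hl hlt =>
        (Finset.mem_insert.1 (hlow i (Finset.mem_insert_of_mem hi) l hl hlt)).resolve_left ?_]
    · simp only [Int.fract]
      rw [show z a + ∑ i ∈ S, z i + u = ∑ i ∈ S, z i + z a + u by ring]
      ring
    · rintro rfl
      exact (hlt.trans_le (hmax i hi)).false

section Rounding

variable {ι : Type*} [Fintype ι]

/-- The amount of supply of effective cost below `τ` when supplier `i` is upgraded to the
extent `z i`. -/
noncomputable def levelMass (b c z : ι → ℝ) (τ : ℝ) : ℝ :=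
  ∑ i, ((if b i < τ then z i else 0) + (if c i < τ then 1 - z i else 0))

/-- The layered cost of a supply distribution `N` against a demand distribution `D`. -/
noncomputable def layerCost (R T : Finset ℝ) (G g : ℝ → ℝ) (D : ℝ → ℕ) (N : ℝ → ℝ) : ℝ :=
  ∑ ρ ∈ R, ∑ τ ∈ T, G ρ * g τ * max 0 ((D ρ : ℝ) - N τ)

theorem layerCost_anti {R T : Finset ℝ} {G g : ℝ → ℝ} (hG : ∀ ρ, 0 ≤ G ρ) (hg : ∀ τ, 0 ≤ g τ)
    (D : ℝ → ℕ) {N N' : ℝ → ℝ} (h : ∀ τ, N τ ≤ N' τ) :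
    layerCost R T G g D N' ≤ layerCost R T G g D N := by
  refine Finset.sum_le_sum fun ρ _ => Finset.sum_le_sum fun τ _ => ?_
  exact mul_le_mul_of_nonneg_left (max_le_max le_rfl (by linarith [h τ]))
    (mul_nonneg (hG ρ) (hg τ))

theorem levelMass_sub (b c z z' : ι → ℝ) (τ : ℝ) :
    levelMass b c z τ - levelMass b c z' τ =
      ∑ i, ((if b i < τ then 1 else 0) - (if c i < τ then 1 else 0)) * (z i - z' i) := by
  rw [levelMass, levelMass, ← Finset.sum_sub_distrib]
  refine Finset.sum_congr rfl fun i _ => ?_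
  split_ifs <;> ring

/-- Systematic sampling: if the cost intervals of the fractionally upgraded suppliers are not
nested, the upgrade vector can be rounded with every level mass changing by less than `1` and
without increasing a given linear functional. -/
theorem exists_systematic_sample [DecidableEq ι] (b c z : ι → ℝ)
    (hz0 : ∀ i, 0 ≤ z i) (hz1 : ∀ i, z i ≤ 1) (k : ℕ) (hk : ∑ i, z i = k)
    (hclean : ∀ i i', i ≠ i' → 0 < z i → z i < 1 → 0 < z i' → z i' < 1 →
      ¬ (b i ≤ b i' ∧ c i' ≤ c i)) (w : ι → ℝ) :
    ∃ A : Finset ι, A.card = k ∧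
      ∑ i, w i * (if i ∈ A then 1 else 0) ≤ ∑ i, w i * z i ∧
      ∀ τ, |levelMass b c (fun i => if i ∈ A then 1 else 0) τ - levelMass b c z τ| < 1 := by
  classical
  set I : Finset ι := Finset.univ.filter fun i => 0 < z i ∧ z i < 1 with hI
  have memI : ∀ i, i ∈ I ↔ 0 < z i ∧ z i < 1 := fun i => by simp [hI]
  have hord : ∀ i ∈ I, ∀ i' ∈ I, b i ≤ b i' → i ≠ i' → c i < c i' := fun i hi i' hi' h hne => by
    by_contra! hc
    exact hclean i i' hne ((memI i).1 hi).1 ((memI i).1 hi).2 ((memI i').1 hi').1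
      ((memI i').1 hi').2 ⟨h, hc⟩
  have hinj : Set.InjOn b I := fun i hi i' hi' h => by
    by_contra hne
    exact (hord i hi i' hi' h.le hne).asymm (hord i' hi' i hi h.ge (Ne.symm hne))
  set Z : ι → ℝ := fun i => ∑ l ∈ I with b l < b i, z l with hZ
  obtain ⟨u, hu⟩ := exists_shift_floor_le w (fun i => Z i + z i) Z
  set a : ι → ℤ := fun i => ⌊Z i + z i + u⌋ - ⌊Z i + u⌋ with ha
  have ha0 : ∀ i, 0 ≤ a i := fun i =>
    sub_nonneg.2 (Int.floor_mono (by linarith [hz0 i]))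
  have ha1 : ∀ i, a i ≤ 1 := fun i => by
    have : ⌊Z i + z i + u⌋ ≤ ⌊Z i + u + 1⌋ := Int.floor_mono (by linarith [hz1 i])
    rw [Int.floor_add_one] at this
    simp only [ha]; omega
  have haout : ∀ i, i ∉ I → (a i : ℝ) = z i := fun i hi => by
    rw [memI, not_and, not_lt] at hi
    rcases (hz0 i).eq_or_lt with h | h
    · simp [ha, ← h]
    · have h1 : z i = 1 := le_antisymm (hz1 i) (hi h)
      have : ⌊Z i + z i + u⌋ = ⌊Z i + u⌋ + 1 := by
        rw [h1, ← Int.floor_add_one]; congr 1; ring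
      have hai : a i = 1 := by simp only [ha, this, add_sub_cancel_left]
      rw [hai, h1, Int.cast_one]
  have hind : ∀ i, (if i ∈ Finset.univ.filter (fun i => a i = 1) then (1 : ℝ) else 0) = a i :=
    fun i => by
      by_cases h : a i = 1
      · simp [h]
      · have : a i = 0 := by have := ha0 i; have := ha1 i; omega
        simp [this]
  have hlower : ∀ S ⊆ I, (∀ i ∈ S, ∀ l ∈ I, b l < b i → l ∈ S) →
      ∑ i ∈ S, ((a i : ℝ) - z i) = Int.fract u - Int.fract (∑ i ∈ S, z i + u) := fun S hS hl => by
    rw [← sum_floor_sub_of_lower b z I S hinj u hS hl]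
    exact Finset.sum_congr rfl fun i _ => by simp [ha, hZ]
  have hrestrict : ∀ f : ι → ℝ, ∑ i, f i * ((a i : ℝ) - z i) = ∑ i ∈ I, f i * ((a i : ℝ) - z i) :=
    fun f => (Finset.sum_subset (Finset.subset_univ I) fun i _ hi => by
      rw [haout i hi, sub_self, mul_zero]).symm
  have hfr : ∀ x y : ℝ, |Int.fract x - Int.fract y| < 1 := fun x y =>
    abs_lt.2 ⟨by linarith [Int.fract_nonneg x, Int.fract_lt_one y],
      by linarith [Int.fract_nonneg y, Int.fract_lt_one x]⟩
  refine ⟨Finset.univ.filter fun i => a i = 1, ?_, ?_, fun τ => ?_⟩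
  · have hcard : (((Finset.univ.filter fun i => a i = 1).card : ℤ) : ℝ) = ∑ i, (a i : ℝ) := by
      rw [← Finset.sum_congr rfl fun i _ => hind i]
      simp
    have hdiff : ∑ i, (a i : ℝ) - k = Int.fract u - Int.fract (∑ i ∈ I, z i + u) := by
      rw [← hlower I subset_rfl fun _ _ l hl _ => hl, ← hk, ← Finset.sum_sub_distrib]
      simpa using hrestrict 1
    have habs := hfr u (∑ i ∈ I, z i + u)
    rw [← hdiff, ← hcard] at habs
    have : |((Finset.univ.filter fun i => a i = 1).card : ℤ) - (k : ℤ)| < 1 := by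
      exact_mod_cast habs
    rw [Int.abs_lt_one_iff] at this
    omega
  · simp only [hind]
    simpa [ha] using hu
  · rw [levelMass_sub]
    simp only [hind]
    rw [hrestrict]
    have hsplit : ∑ i ∈ I, ((if b i < τ then (1 : ℝ) else 0) - (if c i < τ then 1 else 0))
          * ((a i : ℝ) - z i)
        = ∑ i ∈ I with b i < τ, ((a i : ℝ) - z i) - ∑ i ∈ I with c i < τ, ((a i : ℝ) - z i) := by
      rw [Finset.sum_filter (s := I), Finset.sum_filter (s := I), ← Finset.sum_sub_distrib]
      refine Finset.sum_congr rfl fun i _ => ?_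
      split_ifs <;> ring
    rw [hsplit, hlower _ (Finset.filter_subset _ _) fun i hi l hl hlt =>
        Finset.mem_filter.2 ⟨hl, hlt.trans (Finset.mem_filter.1 hi).2⟩,
      hlower _ (Finset.filter_subset _ _) fun i hi l hl hlt => ?_, sub_sub_sub_cancel_left]
    · exact hfr _ _
    · obtain ⟨hiI, hi⟩ := Finset.mem_filter.1 hi
      refine Finset.mem_filter.2 ⟨hl, (hord l hl i hiI hlt.le ?_).trans hi⟩
      rintro rfl
      exact hlt.false

theorem exists_rounding_of_clean [DecidableEq ι] (b c z : ι → ℝ)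
    (hz0 : ∀ i, 0 ≤ z i) (hz1 : ∀ i, z i ≤ 1) (k : ℕ) (hk : ∑ i, z i = k)
    (hclean : ∀ i i', i ≠ i' → 0 < z i → z i < 1 → 0 < z i' → z i' < 1 →
      ¬ (b i ≤ b i' ∧ c i' ≤ c i)) (R T : Finset ℝ) (G g : ℝ → ℝ) (D : ℝ → ℕ) :
    ∃ A : Finset ι, A.card = k ∧
      layerCost R T G g D (levelMass b c fun i => if i ∈ A then 1 else 0) ≤
        layerCost R T G g D (levelMass b c z) := by
  classical
  set χ : ℝ → ℝ → ℝ := fun ρ τ => if levelMass b c z τ < D ρ then 1 else 0 with hχ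
  set w : ι → ℝ := fun i => ∑ ρ ∈ R, ∑ τ ∈ T, -(G ρ * g τ * χ ρ τ *
    ((if b i < τ then 1 else 0) - (if c i < τ then 1 else 0))) with hw
  obtain ⟨A, hA, hwA, hNA⟩ := exists_systematic_sample b c z hz0 hz1 k hk hclean w
  refine ⟨A, hA, ?_⟩
  set y : ι → ℝ := fun i => if i ∈ A then 1 else 0 with hy
  have hint : ∀ τ, ∃ m : ℤ, levelMass b c y τ = m := fun τ =>
    ⟨∑ i, ((if b i < τ then (if i ∈ A then 1 else 0) else 0) +
      (if c i < τ then 1 - (if i ∈ A then 1 else 0) else 0)), by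
      push_cast [levelMass, hy]; rfl⟩
  have hmaxz : ∀ ρ τ, max 0 ((D ρ : ℝ) - levelMass b c z τ)
      = χ ρ τ * ((D ρ : ℝ) - levelMass b c z τ) := fun ρ τ => by
    by_cases h : levelMass b c z τ < D ρ
    · simp [hχ, h, h.le]
    · simp [hχ, h, not_lt.1 h]
  have hmaxy : ∀ ρ τ, max 0 ((D ρ : ℝ) - levelMass b c y τ)
      = χ ρ τ * ((D ρ : ℝ) - levelMass b c y τ) := fun ρ τ => by
    obtain ⟨m, hm⟩ := hint τ
    have hlt := abs_lt.1 (hNA τ)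
    rw [hm] at hlt ⊢
    by_cases h : levelMass b c z τ < D ρ
    · have h1 : (m : ℝ) < ((D ρ : ℤ) : ℝ) + 1 := by push_cast; linarith
      have h2 : m ≤ (D ρ : ℤ) := Int.lt_add_one_iff.1 (by exact_mod_cast h1)
      have h3 : (m : ℝ) ≤ D ρ := by exact_mod_cast h2
      simp [hχ, h, h3]
    · have h1 : ((D ρ : ℤ) : ℝ) < m + 1 := by push_cast; linarith
      have h2 : (D ρ : ℤ) ≤ m := Int.lt_add_one_iff.1 (by exact_mod_cast h1)
      have h3 : (D ρ : ℝ) ≤ m := by exact_mod_cast h2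
      simp [hχ, h, h3]
  have hdiff : layerCost R T G g D (levelMass b c y) - layerCost R T G g D (levelMass b c z)
      = ∑ i, w i * (y i - z i) := by
    simp only [layerCost, hmaxz, hmaxy, hw, Finset.sum_mul]
    rw [Finset.sum_comm (s := Finset.univ), ← Finset.sum_sub_distrib]
    refine Finset.sum_congr rfl fun ρ _ => ?_
    rw [Finset.sum_comm (s := Finset.univ), ← Finset.sum_sub_distrib]
    refine Finset.sum_congr rfl fun τ _ => ?_
    have := levelMass_sub b c y z τ
    calc _ = -(G ρ * g τ * χ ρ τ) * (levelMass b c y τ - levelMass b c z τ) := by ring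
      _ = _ := by
        rw [this, Finset.mul_sum]
        exact Finset.sum_congr rfl fun i _ => by ring
  have hle : ∑ i, w i * (y i - z i) ≤ 0 := by
    simp only [mul_sub, Finset.sum_sub_distrib]
    linarith
  linarith

/-- Any fractional upgrade vector of integral total can be rounded to a set without increasing
the layered cost. -/
theorem exists_rounding [DecidableEq ι] (b c : ι → ℝ) (hbc : ∀ i, b i ≤ c i)
    (R T : Finset ℝ) (G g : ℝ → ℝ) (hG : ∀ ρ, 0 ≤ G ρ) (hg : ∀ τ, 0 ≤ g τ) (D : ℝ → ℕ) (k : ℕ)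
    (z : ι → ℝ) (hz0 : ∀ i, 0 ≤ z i) (hz1 : ∀ i, z i ≤ 1) (hk : ∑ i, z i = k) :
    ∃ A : Finset ι, A.card = k ∧
      layerCost R T G g D (levelMass b c fun i => if i ∈ A then 1 else 0) ≤
        layerCost R T G g D (levelMass b c z) := by
  classical
  induction hm : (Finset.univ.filter fun i => 0 < z i ∧ z i < 1).card using
    Nat.strong_induction_on generalizing z with
  | _ m ih =>
  by_cases hclean : ∀ i i', i ≠ i' → 0 < z i → z i < 1 → 0 < z i' → z i' < 1 →
      ¬ (b i ≤ b i' ∧ c i' ≤ c i)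
  · exact exists_rounding_of_clean b c z hz0 hz1 k hk hclean R T G g D
  push Not at hclean
  obtain ⟨p, q, hpq, hp0, hp1, hq0, hq1, hbpq, hcpq⟩ := hclean
  set ε := min (1 - z p) (z q) with hε
  have hεp : ε ≤ 1 - z p := min_le_left _ _
  have hεq : ε ≤ z q := min_le_right _ _
  have hε0 : 0 < ε := lt_min (by linarith) hq0
  set y : ι → ℝ := fun i => z i + ((if i = p then ε else 0) - if i = q then ε else 0) with hy
  have hyp : y p = z p + ε := by simp [hy, hpq]
  have hyq : y q = z q - ε := by simp [hy, hpq.symm, sub_eq_add_neg]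
  have hyo : ∀ i, i ≠ p → i ≠ q → y i = z i := fun i h h' => by simp [hy, h, h']
  have hcases : ∀ i, i = p ∨ i = q ∨ y i = z i := fun i => by
    by_cases h : i = p
    · exact .inl h
    · by_cases h' : i = q
      · exact .inr (.inl h')
      · exact .inr (.inr (hyo i h h'))
  have hy0 : ∀ i, 0 ≤ y i := fun i => by
    rcases hcases i with rfl | rfl | h
    · linarith
    · linarith
    · rw [h]; exact hz0 i
  have hy1 : ∀ i, y i ≤ 1 := fun i => by
    rcases hcases i with rfl | rfl | h
    · linarith
    · linarith
    · rw [h]; exact hz1 i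
  have hyk : ∑ i, y i = k := by
    simp [hy, Finset.sum_add_distrib, hk]
  have hmass : ∀ τ, levelMass b c z τ ≤ levelMass b c y τ := fun τ => by
    rw [← sub_nonneg, levelMass_sub]
    have : ∀ i, ((if b i < τ then (1 : ℝ) else 0) - (if c i < τ then 1 else 0)) * (y i - z i)
        = (if i = p then
            ((if b i < τ then (1 : ℝ) else 0) - (if c i < τ then 1 else 0)) * ε else 0)
          - (if i = q then
            ((if b i < τ then (1 : ℝ) else 0) - (if c i < τ then 1 else 0)) * ε else 0) :=
      fun i => by
        simp only [hy, add_sub_cancel_left, mul_sub, mul_ite, mul_zero]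
    simp only [this, Finset.sum_sub_distrib, Finset.sum_ite_eq', Finset.mem_univ, if_true]
    rw [← sub_mul]
    refine mul_nonneg ?_ hε0.le
    have := hbc p
    have := hbc q
    split_ifs <;> first | (exfalso; linarith) | norm_num
  have hlt : (Finset.univ.filter fun i => 0 < y i ∧ y i < 1).card < m := by
    rw [← hm]
    refine Finset.card_lt_card (Finset.ssubset_iff_subset_ne.2 ⟨fun i hi => ?_, fun heq => ?_⟩)
    · simp only [Finset.mem_filter, Finset.mem_univ, true_and] at hi ⊢
      rcases hcases i with rfl | rfl | h
      · exact ⟨hp0, hp1⟩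
      · exact ⟨hq0, hq1⟩
      · rwa [← h]
    · have hpy : p ∈ Finset.univ.filter fun i => 0 < y i ∧ y i < 1 := by
        rw [heq]; simp [hp0, hp1]
      have hqy : q ∈ Finset.univ.filter fun i => 0 < y i ∧ y i < 1 := by
        rw [heq]; simp [hq0, hq1]
      simp only [Finset.mem_filter, Finset.mem_univ, true_and] at hpy hqy
      rcases min_choice (1 - z p) (z q) with h | h
      · linarith [hpy.2, hε.trans h]
      · linarith [hqy.1, hε.trans h]
  obtain ⟨A, hA, hle⟩ := ih _ hlt y hy0 hy1 hyk rfl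
  exact ⟨A, hA, hle.trans (layerCost_anti hG hg D hmass)⟩

end Rounding

theorem exists_perm_antivary {n : ℕ} (e d : Fin n → ℝ) :
    ∃ π : Equiv.Perm (Fin n), Antivary (e ∘ π) d := by
  set σ := Tuple.sort e
  set ν := Tuple.sort (-d)
  refine ⟨ν.symm.trans σ, fun i j hij => ?_⟩
  have hν : Monotone ((-d) ∘ ν) := Tuple.monotone_sort (-d)
  have hσ : Monotone (e ∘ σ) := Tuple.monotone_sort e
  refine hσ (le_of_not_gt fun h => ?_)
  have := hν h.le
  simp only [Function.comp_apply, Equiv.apply_symm_apply, Pi.neg_apply] at this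
  linarith

/-- Layer-cake form of a product. -/
theorem mul_eq_sum_layers {R T : Finset ℝ} {G g : ℝ → ℝ} {s t : ℝ}
    (hs : s = ∑ τ ∈ T, if τ ≤ s then g τ else 0) (ht : t = ∑ ρ ∈ R, if ρ ≤ t then G ρ else 0) :
    s * t = ∑ ρ ∈ R, ∑ τ ∈ T, G ρ * g τ * (if τ ≤ s ∧ ρ ≤ t then 1 else 0) := by
  conv_lhs => rw [hs, ht, mul_comm, Finset.sum_mul_sum]
  refine Finset.sum_congr rfl fun ρ _ => Finset.sum_congr rfl fun τ _ => ?_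
  by_cases h : τ ≤ s <;> by_cases h' : ρ ≤ t <;> simp [h, h']

theorem cost_le_layerCost {n : ℕ} (b c d : Fin n → ℝ) (A : Finset (Fin n))
    {R T : Finset ℝ} {G g : ℝ → ℝ} (hG : ∀ ρ, 0 ≤ G ρ) (hg : ∀ τ, 0 ≤ g τ)
    (hb : ∀ i, b i = ∑ τ ∈ T, if τ ≤ b i then g τ else 0)
    (hc : ∀ i, c i = ∑ τ ∈ T, if τ ≤ c i then g τ else 0)
    (hd : ∀ j, d j = ∑ ρ ∈ R, if ρ ≤ d j then G ρ else 0) :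
    cost b c d A ≤ layerCost R T G g (fun ρ => (Finset.univ.filter fun j => ρ ≤ d j).card)
      (levelMass b c fun i => if i ∈ A then 1 else 0) := by
  set e : Fin n → ℝ := fun i => if i ∈ A then b i else c i with he
  have hes : ∀ i, e i = ∑ τ ∈ T, if τ ≤ e i then g τ else 0 := fun i => by
    by_cases h : i ∈ A
    · simpa [he, h] using hb i
    · simpa [he, h] using hc i
  obtain ⟨π, hπ⟩ := exists_perm_antivary e d
  refine (Finset.inf'_le _ (Finset.mem_univ π)).trans ?_
  have hcost : assignCost b c d A π = ∑ ρ ∈ R, ∑ τ ∈ T, G ρ * g τ *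
      ((Finset.univ.filter fun j => τ ≤ e (π j) ∧ ρ ≤ d j).card : ℝ) := by
    calc assignCost b c d A π = ∑ j, e (π j) * d j := rfl
      _ = ∑ j, ∑ ρ ∈ R, ∑ τ ∈ T, G ρ * g τ * (if τ ≤ e (π j) ∧ ρ ≤ d j then 1 else 0) :=
        Finset.sum_congr rfl fun j _ => mul_eq_sum_layers (hes (π j)) (hd j)
      _ = _ := by
        rw [Finset.sum_comm]
        refine Finset.sum_congr rfl fun ρ _ => ?_
        rw [Finset.sum_comm]
        refine Finset.sum_congr rfl fun τ _ => ?_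
        rw [← Finset.mul_sum, Finset.sum_boole]
  rw [hcost]
  refine Finset.sum_le_sum fun ρ _ => Finset.sum_le_sum fun τ _ =>
    mul_le_mul_of_nonneg_left ?_ (mul_nonneg (hG ρ) (hg τ))
  have hmass : levelMass b c (fun i => if i ∈ A then 1 else 0) τ
      = ((Finset.univ.filter fun j => e (π j) < τ).card : ℝ) := by
    rw [← Finset.sum_boole, Equiv.sum_comp π fun i => if e i < τ then (1 : ℝ) else 0, levelMass]
    refine Finset.sum_congr rfl fun i _ => ?_
    by_cases h : i ∈ A <;> simp [he, h]
  rw [hmass]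
  by_cases hsub : ∃ j, ρ ≤ d j ∧ τ ≤ e (π j)
  · obtain ⟨j, hj, hej⟩ := hsub
    have hincl : (Finset.univ.filter fun j => e (π j) < τ) ⊆
        Finset.univ.filter fun j => ρ ≤ d j := fun l hl => by
      simp only [Finset.mem_filter, Finset.mem_univ, true_and] at hl ⊢
      by_contra! hlt
      have := hπ (hlt.trans_le hj)
      simp only [Function.comp_apply] at this
      linarith
    have hset : (Finset.univ.filter fun j => τ ≤ e (π j) ∧ ρ ≤ d j) =
        (Finset.univ.filter fun j => ρ ≤ d j) \ Finset.univ.filter fun j => e (π j) < τ := by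
      ext l
      simp [and_comm]
    rw [hset, Finset.cast_card_sdiff hincl]
    exact le_max_right _ _
  · push Not at hsub
    have : (Finset.univ.filter fun j => τ ≤ e (π j) ∧ ρ ≤ d j) = ∅ :=
      Finset.filter_eq_empty_iff.2 fun j _ h => (hsub j h.2).not_ge h.1
    rw [this]
    simp

theorem layerCost_le_obj {n k : ℕ} (b c d : Fin n → ℝ)
    {R T : Finset ℝ} {G g : ℝ → ℝ} (hG : ∀ ρ, 0 ≤ G ρ) (hg : ∀ τ, 0 ≤ g τ)
    (hb : ∀ i, b i = ∑ τ ∈ T, if τ ≤ b i then g τ else 0)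
    (hc : ∀ i, c i = ∑ τ ∈ T, if τ ≤ c i then g τ else 0)
    (hd : ∀ j, d j = ∑ ρ ∈ R, if ρ ≤ d j then G ρ else 0)
    {p : (Fin n → Fin n → ℝ) × (Fin n → Fin n → ℝ)} (hp : p ∈ Pk n k) :
    layerCost R T G g (fun ρ => (Finset.univ.filter fun j => ρ ≤ d j).card)
      (levelMass b c fun i => ∑ j, p.1 i j) ≤ obj b c d p := by
  obtain ⟨hx, hy, hcol, hrow, -⟩ := hp
  have hobj : obj b c d p = ∑ ρ ∈ R, ∑ τ ∈ T, G ρ * g τ * ∑ i, ∑ j,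
      (p.1 i j * (if τ ≤ b i ∧ ρ ≤ d j then 1 else 0) +
        p.2 i j * (if τ ≤ c i ∧ ρ ≤ d j then 1 else 0)) := by
    calc obj b c d p = ∑ i, ∑ j, (p.1 i j * (b i * d j) + p.2 i j * (c i * d j)) :=
        Finset.sum_congr rfl fun i _ => Finset.sum_congr rfl fun j _ => by ring
      _ = ∑ i, ∑ j, ∑ ρ ∈ R, ∑ τ ∈ T, G ρ * g τ *
          (p.1 i j * (if τ ≤ b i ∧ ρ ≤ d j then 1 else 0) +
            p.2 i j * (if τ ≤ c i ∧ ρ ≤ d j then 1 else 0)) := by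
        refine Finset.sum_congr rfl fun i _ => Finset.sum_congr rfl fun j _ => ?_
        rw [mul_eq_sum_layers (hb i) (hd j), mul_eq_sum_layers (hc i) (hd j), Finset.mul_sum,
          Finset.mul_sum, ← Finset.sum_add_distrib]
        refine Finset.sum_congr rfl fun ρ _ => ?_
        rw [Finset.mul_sum, Finset.mul_sum, ← Finset.sum_add_distrib]
        exact Finset.sum_congr rfl fun τ _ => by ring
      _ = ∑ i, ∑ ρ ∈ R, ∑ τ ∈ T, ∑ j, G ρ * g τ *
          (p.1 i j * (if τ ≤ b i ∧ ρ ≤ d j then 1 else 0) +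
            p.2 i j * (if τ ≤ c i ∧ ρ ≤ d j then 1 else 0)) := by
        refine Finset.sum_congr rfl fun i _ => ?_
        rw [Finset.sum_comm]
        exact Finset.sum_congr rfl fun ρ _ => Finset.sum_comm
      _ = _ := by
        rw [Finset.sum_comm]
        refine Finset.sum_congr rfl fun ρ _ => ?_
        rw [Finset.sum_comm]
        refine Finset.sum_congr rfl fun τ _ => ?_
        simp only [Finset.mul_sum]
  rw [hobj]
  refine Finset.sum_le_sum fun ρ _ => Finset.sum_le_sum fun τ _ =>
    mul_le_mul_of_nonneg_left (max_le ?_ ?_) (mul_nonneg (hG ρ) (hg τ))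
  · refine Finset.sum_nonneg fun i _ => Finset.sum_nonneg fun j _ => ?_
    have := hx i j
    have := hy i j
    positivity
  have hD : ((Finset.univ.filter fun j => ρ ≤ d j).card : ℝ)
      = ∑ i, ∑ j, (p.1 i j + p.2 i j) * (if ρ ≤ d j then 1 else 0) := by
    rw [Finset.sum_comm, ← Finset.sum_boole]
    exact Finset.sum_congr rfl fun j _ => by rw [← Finset.sum_mul, hcol, one_mul]
  have hN : levelMass b c (fun i => ∑ j, p.1 i j) τ = ∑ i, ∑ j,
      (p.1 i j * (if b i < τ then 1 else 0) + p.2 i j * (if c i < τ then 1 else 0)) := by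
    refine Finset.sum_congr rfl fun i _ => ?_
    have : 1 - ∑ j, p.1 i j = ∑ j, p.2 i j := by
      rw [← hrow i, Finset.sum_add_distrib, add_sub_cancel_left]
    rw [this, Finset.sum_add_distrib, ← Finset.sum_mul, ← Finset.sum_mul]
    simp
  rw [hD, hN, ← Finset.sum_sub_distrib]
  refine Finset.sum_le_sum fun i _ => ?_
  rw [← Finset.sum_sub_distrib]
  refine Finset.sum_le_sum fun j _ => ?_
  have := hx i j
  have := hy i j
  simp only [← not_lt (a := b i), ← not_lt (a := c i)]
  by_cases h1 : b i < τ <;> by_cases h2 : c i < τ <;> by_cases h3 : ρ ≤ d j <;>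
    simp [h1, h2, h3] <;> linarith

/-- Every feasible LP point is dominated by an upgrade set. -/
theorem exists_cost_le_obj {n k : ℕ} {b c d : Fin n → ℝ} (hb : ∀ i, 0 ≤ b i)
    (hbc : ∀ i, b i ≤ c i) (hd : ∀ j, 0 ≤ d j)
    {p : (Fin n → Fin n → ℝ) × (Fin n → Fin n → ℝ)} (hp : p ∈ Pk n k) :
    ∃ A : Finset (Fin n), A.card ≤ k ∧ cost b c d A ≤ obj b c d p := by
  obtain ⟨g, hg, hgT, -⟩ := exists_layer_weights (Finset.univ.image b ∪ Finset.univ.image c) (by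
    simp only [Finset.mem_union, Finset.mem_image, Finset.mem_univ, true_and]
    rintro s (⟨i, rfl⟩ | ⟨i, rfl⟩)
    · exact hb i
    · exact (hb i).trans (hbc i))
  obtain ⟨G, hG, hGR, -⟩ := exists_layer_weights (Finset.univ.image d) (by simpa using hd)
  have hgb := fun i => hgT (b i) (by simp)
  have hgc := fun i => hgT (c i) (by simp)
  have hGd := fun j => hGR (d j) (by simp)
  have hobj := layerCost_le_obj b c d hG hg hgb hgc hGd hp
  obtain ⟨hx, hy, -, hrow, hk⟩ := hp
  set z : Fin n → ℝ := fun i => ∑ j, p.1 i j with hz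
  have hz0 : ∀ i, 0 ≤ z i := fun i => Finset.sum_nonneg fun j _ => hx i j
  have hz1 : ∀ i, z i ≤ 1 := fun i => by
    rw [← hrow i]
    exact Finset.sum_le_sum fun j _ => le_add_of_nonneg_right (hy i j)
  have hzn : ∑ i, z i ≤ n := by
    simpa using Finset.sum_le_sum fun (i : Fin n) (_ : i ∈ Finset.univ) => hz1 i
  obtain ⟨t, ht0, ht1, ht⟩ : ∃ t : ℝ, 0 ≤ t ∧ t ≤ 1 ∧
      ∑ i, z i + t * (n - ∑ i, z i) = (min k n : ℕ) := by
    have h1 : ∑ i, z i ≤ (min k n : ℕ) := by push_cast; exact le_min hk hzn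
    have h2 : ((min k n : ℕ) : ℝ) ≤ n := by exact_mod_cast min_le_right k n
    rcases hzn.eq_or_lt with h | h
    · exact ⟨0, le_rfl, zero_le_one, by linarith⟩
    · refine ⟨((min k n : ℕ) - ∑ i, z i) / (n - ∑ i, z i), div_nonneg (by linarith) (by linarith),
        (div_le_one (by linarith)).2 (by linarith), ?_⟩
      rw [div_mul_cancel₀ _ (by linarith)]
      ring
  have hmass : ∀ τ, levelMass b c z τ ≤ levelMass b c (fun i => z i + t * (1 - z i)) τ :=
    fun τ => by
      rw [← sub_nonneg, levelMass_sub]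
      refine Finset.sum_nonneg fun i _ => mul_nonneg ?_ ?_
      · have := hbc i
        split_ifs <;> first | (exfalso; linarith) | norm_num
      · linarith [mul_nonneg ht0 (sub_nonneg.2 (hz1 i))]
  obtain ⟨A, hA, hle⟩ := exists_rounding b c hbc (Finset.univ.image d)
    (Finset.univ.image b ∪ Finset.univ.image c) G g hG hg
    (fun ρ => (Finset.univ.filter fun j => ρ ≤ d j).card) (min k n)
    (fun i => z i + t * (1 - z i))
    (fun i => add_nonneg (hz0 i) (mul_nonneg ht0 (sub_nonneg.2 (hz1 i))))
    (fun i => by nlinarith [mul_nonneg (sub_nonneg.2 ht1) (sub_nonneg.2 (hz1 i))])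
    (by
      rw [← ht, Finset.sum_add_distrib, ← Finset.mul_sum, Finset.sum_sub_distrib]
      simp)
  exact ⟨A, hA.trans_le (min_le_left k n),
    (cost_le_layerCost b c d A hG hg hgb hgc hGd).trans
      (hle.trans ((layerCost_anti hG hg _ hmass).trans hobj))⟩

theorem chi_mem_Pk {n k : ℕ} (π : Equiv.Perm (Fin n)) {A : Finset (Fin n)} (hA : A.card ≤ k) :
    chi π A ∈ Pk n k := by
  have hsum : ∀ i j, (chi π A).1 i j + (chi π A).2 i j = if π j = i then 1 else 0 := fun i j => by
    by_cases h : π j = i <;> by_cases h' : i ∈ A <;> simp [chi, h, h']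
  refine ⟨fun i j => ?_, fun i j => ?_, fun j => ?_, fun i => ?_, ?_⟩
  · simp only [chi]; positivity
  · simp only [chi]; positivity
  · simp [hsum]
  · simp [hsum, ← Equiv.eq_symm_apply]
  · have : ∀ i, ∑ j, (chi π A).1 i j = if i ∈ A then 1 else 0 := fun i => by
      by_cases h : i ∈ A <;> simp [chi, h, ← Equiv.eq_symm_apply]
    simp only [this, Finset.sum_boole]
    simpa using hA

theorem integral_chi {n : ℕ} (π : Equiv.Perm (Fin n)) (A : Finset (Fin n)) :
    Integral (chi π A) :=
  ⟨fun _ _ => (ite_eq_or_eq _ _ _).symm, fun _ _ => (ite_eq_or_eq _ _ _).symm⟩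

theorem obj_chi {n : ℕ} (b c d : Fin n → ℝ) (π : Equiv.Perm (Fin n)) (A : Finset (Fin n)) :
    obj b c d (chi π A) = assignCost b c d A π := by
  rw [obj, Finset.sum_comm, assignCost]
  refine Finset.sum_congr rfl fun j _ => ?_
  rw [Finset.sum_eq_single (π j) (fun i _ hi => by simp [chi, hi.symm]) (by simp)]
  by_cases h : π j ∈ A <;> simp [chi, h]

/-- the minimum of the LP objective over `P(k)` equals the
minimum of `cost A` over all `A` with `|A| ≤ k`; in particular `P(k)`
has an integral optimal solution. -/
theorem stmt1 (n : ℕ) (hn : 1 ≤ n) (b c d : Fin n → ℝ)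
    (hb : ∀ i, 0 ≤ b i) (hbc : ∀ i, b i ≤ c i) (hd : ∀ j, 0 ≤ d j) (k : ℕ) :
    ∃ v : ℝ, IsLeast (obj b c d '' Pk n k) v ∧
      IsLeast ((fun A : Finset (Fin n) => cost b c d A) ''
        {A : Finset (Fin n) | A.card ≤ k}) v ∧
      ∃ p ∈ Pk n k, Integral p ∧ obj b c d p = v := by
  obtain ⟨A, hA, hmin⟩ := Finset.exists_min_image
    (Finset.univ.filter fun A : Finset (Fin n) => A.card ≤ k) (cost b c d) ⟨∅, by simp⟩
  simp only [Finset.mem_filter, Finset.mem_univ, true_and] at hA hmin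
  obtain ⟨π, -, hπ⟩ := Finset.exists_mem_eq_inf' Finset.univ_nonempty (assignCost b c d A)
  have hchi : obj b c d (chi π A) = cost b c d A := (obj_chi b c d π A).trans hπ.symm
  refine ⟨cost b c d A, ⟨⟨chi π A, chi_mem_Pk π hA, hchi⟩, ?_⟩, ⟨⟨A, hA, rfl⟩, ?_⟩,
    chi π A, chi_mem_Pk π hA, integral_chi π A, hchi⟩
  · rintro _ ⟨p, hp, rfl⟩
    obtain ⟨B, hB, hle⟩ := exists_cost_le_obj hb hbc hd hp
    exact (hmin B hB).trans hle
  · rintro _ ⟨B, hB, rfl⟩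
    exact hmin B hB
end

section
/- Assume the 2n real numbers b i (i ∈ Fin n) and c i (i ∈ Fin n) are pairwise distinct and the n real numbers d j (j ∈ Fin n) are pairwise distinct. Then for every k ∈ ℕ, every extreme point (x, y) of P(k) at which obj attains its minimum over P(k) is integral, i.e. every entry of x and y lies in {0, 1}. -/
open Finset

theorem Finset.sum_sub_of_isLowerSet {α : Type*} [DecidableEq α] (v : α → ℝ)
    (hv : Function.Injective v) (m : α → ℝ) (f : ℝ → ℝ) (F T : Finset α) (hTF : T ⊆ F)
    (hT : ∀ a ∈ T, ∀ a' ∈ F, v a' ≤ v a → a' ∈ T) :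
    ∑ a ∈ T, (f (∑ a' ∈ F with v a' ≤ v a, m a') - f (∑ a' ∈ F with v a' < v a, m a')) =
      f (∑ a ∈ T, m a) - f 0 := by
  induction T using Finset.induction_on_max_value v with
  | empty => simp
  | insert a T ha hmax ih =>
    have hlt : ∀ x ∈ T, v x < v a := fun x hx =>
      lt_of_le_of_ne (hmax x hx) fun h => ha (hv h ▸ hx)
    have hle : F.filter (fun a' => v a' ≤ v a) = insert a T := by
      ext x
      simp only [Finset.mem_filter]
      refine ⟨fun h => hT a (Finset.mem_insert_self _ _) x h.1 h.2, fun h => ⟨hTF h, ?_⟩⟩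
      rcases Finset.mem_insert.1 h with rfl | h
      · exact le_rfl
      · exact hmax x h
    have hlt' : F.filter (fun a' => v a' < v a) = T := by
      ext x
      simp only [Finset.mem_filter]
      refine ⟨fun h => ?_, fun h => ⟨hTF (Finset.mem_insert_of_mem h), hlt x h⟩⟩
      rcases Finset.mem_insert.1 (hT a (Finset.mem_insert_self _ _) x h.1 h.2.le) with rfl | h'
      · exact absurd h.2 (lt_irrefl _)
      · exact h'
    rw [Finset.sum_insert ha, hle, hlt', ih ((Finset.subset_insert _ _).trans hTF)]
    · ring
    · intro x hx y hy hyx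
      rcases Finset.mem_insert.1 (hT x (Finset.mem_insert_of_mem hx) y hy hyx) with rfl | h
      · exact absurd hyx (not_le.2 (hlt x hx))
      · exact h

noncomputable section

/-- Total mass of the elements whose value is at most that of `a`. -/
def cumLE {α : Type*} [Fintype α] (v m : α → ℝ) (a : α) : ℝ := ∑ a' with v a' ≤ v a, m a'

/-- Total mass of the elements whose value is less than that of `a`. -/
def cumLT {α : Type*} [Fintype α] (v m : α → ℝ) (a : α) : ℝ := ∑ a' with v a' < v a, m a'

/-- The north-west corner coupling of the masses `m` and `μ`, the elements being
ordered by `v` and `w` respectively. -/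
def corner {α β : Type*} [Fintype α] [Fintype β] (v m : α → ℝ) (w μ : β → ℝ)
    (a : α) (b : β) : ℝ :=
  (min (cumLE v m a) (cumLE w μ b) - min (cumLE v m a) (cumLT w μ b)) -
    (min (cumLT v m a) (cumLE w μ b) - min (cumLT v m a) (cumLT w μ b))

end

section Cumulative

variable {α β : Type*} [Fintype α] [Fintype β] {v m : α → ℝ} {w μ : β → ℝ}

theorem cumLE_eq_cumLT_add [DecidableEq α] (hv : Function.Injective v) (m : α → ℝ) (a : α) :
    cumLE v m a = cumLT v m a + m a := by
  have h : Finset.univ.filter (fun a' => v a' ≤ v a) =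
      insert a (Finset.univ.filter (fun a' => v a' < v a)) := by
    ext x
    simp [le_iff_lt_or_eq, hv.eq_iff, or_comm]
  rw [cumLE, cumLT, h, Finset.sum_insert (by simp), add_comm]

theorem cumLT_nonneg (hm : ∀ a, 0 ≤ m a) (a : α) : 0 ≤ cumLT v m a :=
  Finset.sum_nonneg fun _ _ => hm _

theorem cumLT_le_cumLE (hm : ∀ a, 0 ≤ m a) (a : α) : cumLT v m a ≤ cumLE v m a :=
  Finset.sum_le_sum_of_subset_of_nonneg
    (fun x hx => by simp only [Finset.mem_filter] at hx ⊢; exact ⟨hx.1, hx.2.le⟩)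
    fun _ _ _ => hm _

theorem cumLE_le_sum (hm : ∀ a, 0 ≤ m a) (a : α) : cumLE v m a ≤ ∑ a, m a :=
  Finset.sum_le_sum_of_subset_of_nonneg (Finset.filter_subset _ _) fun _ _ _ => hm _

theorem corner_comm (a : α) (b : β) : corner v m w μ a b = corner w μ v m b a := by
  simp only [corner, min_comm (cumLE v m a), min_comm (cumLT v m a)]
  ring

theorem corner_nonneg (hm : ∀ a, 0 ≤ m a) (hμ : ∀ b, 0 ≤ μ b) (a : α) (b : β) :
    0 ≤ corner v m w μ a b := by
  have h₁ := cumLT_le_cumLE (v := v) hm a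
  have h₂ := cumLT_le_cumLE (v := w) hμ b
  rw [corner]
  grind

theorem sum_corner_left [DecidableEq α] [DecidableEq β] (hv : Function.Injective v)
    (hw : Function.Injective w) (hμ : ∀ b, 0 ≤ μ b) (hsum : ∑ a, m a = ∑ b, μ b) (b : β) :
    ∑ a, corner v m w μ a b = μ b := by
  have h := Finset.sum_sub_of_isLowerSet v hv m
    (fun x => min x (cumLE w μ b) - min x (cumLT w μ b)) Finset.univ Finset.univ
    (Finset.Subset.refl _) (fun _ _ _ _ _ => Finset.mem_univ _)
  have h₁ := cumLT_nonneg (v := w) hμ b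
  have h₂ := cumLT_le_cumLE (v := w) hμ b
  have h₃ := cumLE_le_sum (v := w) hμ b
  have h₄ := cumLE_eq_cumLT_add hw μ b
  simp only [corner]
  refine h.trans ?_
  simp only [hsum]
  rw [min_eq_right h₃, min_eq_right (h₂.trans h₃), min_eq_left h₁, min_eq_left (h₁.trans h₂)]
  linarith

theorem sum_corner_right [DecidableEq α] [DecidableEq β] (hv : Function.Injective v)
    (hw : Function.Injective w) (hm : ∀ a, 0 ≤ m a) (hsum : ∑ a, m a = ∑ b, μ b) (a : α) :
    ∑ b, corner v m w μ a b = m a := by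
  simp only [corner_comm (v := v)]
  exact sum_corner_left hw hv hm hsum.symm a

end Cumulative

theorem eq_min_sub_min_of_greedy {β : Type*} [Fintype β] [DecidableEq β] (w : β → ℝ)
    (hw : Function.Injective w) (W : β → ℝ) (h0 : ∀ j, 0 ≤ W j) (h1 : ∀ j, W j ≤ 1)
    (hgreedy : ∀ j j', w j' < w j → 0 < W j → W j' = 1) (j : β) :
    W j = min (∑ j, W j) (cumLE w (fun _ => 1) j) - min (∑ j, W j) (cumLT w (fun _ => 1) j) := by
  have hle := cumLE_eq_cumLT_add hw (fun _ => 1) j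
  have hW := cumLE_eq_cumLT_add hw W j
  have hsplit : ∑ j, W j = cumLE w W j + ∑ j' with ¬ w j' ≤ w j, W j' :=
    (Finset.sum_filter_add_sum_filter_not _ _ _).symm
  have hlow : cumLT w W j ≤ cumLT w (fun _ => 1) j := Finset.sum_le_sum fun x _ => h1 x
  have hup : 0 ≤ ∑ j' with ¬ w j' ≤ w j, W j' := Finset.sum_nonneg fun x _ => h0 x
  have hlow' : 0 < W j → cumLT w W j = cumLT w (fun _ => 1) j := fun h =>
    Finset.sum_congr rfl fun x hx => hgreedy j x (Finset.mem_filter.1 hx).2 h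
  have hup' : W j < 1 → ∑ j' with ¬ w j' ≤ w j, W j' = 0 := fun h =>
    Finset.sum_eq_zero fun x hx => by
      by_contra hne
      have := hgreedy x j (not_le.1 (Finset.mem_filter.1 hx).2)
        (lt_of_le_of_ne (h0 x) (Ne.symm hne))
      linarith
  have := h0 j
  have := h1 j
  rcases eq_or_lt_of_le (h0 j) with h | h
  · have := hup' (by linarith)
    rw [min_eq_left (by linarith), min_eq_left (by linarith)]
    linarith
  · have := hlow' h
    rcases eq_or_lt_of_le (h1 j) with h' | h'
    · rw [min_eq_right (by linarith), min_eq_right (by linarith)]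
      linarith
    · have := hup' h'
      rw [min_eq_left (by linarith), min_eq_right (by linarith)]
      linarith

theorem eq_corner_of_monotone_support {α β : Type*} [Fintype α] [Fintype β] [DecidableEq α]
    [DecidableEq β] (v : α → ℝ) (w : β → ℝ) (hv : Function.Injective v)
    (hw : Function.Injective w) (M : α → β → ℝ) (h0 : ∀ s j, 0 ≤ M s j)
    (hcol : ∀ j, ∑ s, M s j = 1)
    (hmono : ∀ s s' j j', 0 < M s j → 0 < M s' j' → v s < v s' → w j ≤ w j') (s : α) (j : β) :
    M s j = corner v (fun s => ∑ j, M s j) w (fun _ => 1) s j := by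
  have key : ∀ S : Finset α, (∀ s ∈ S, ∀ s' ∉ S, v s < v s') → ∀ j, ∑ s ∈ S, M s j =
      min (∑ s ∈ S, ∑ j, M s j) (cumLE w (fun _ => 1) j) -
        min (∑ s ∈ S, ∑ j, M s j) (cumLT w (fun _ => 1) j) := by
    intro S hS j
    rw [Finset.sum_comm (s := S)]
    refine eq_min_sub_min_of_greedy w hw (fun j => ∑ s ∈ S, M s j)
      (fun j => Finset.sum_nonneg fun s _ => h0 s j) (fun j => ?_) (fun j j' hjj' hpos => ?_) j
    · rw [← hcol j]
      exact Finset.sum_le_sum_of_subset_of_nonneg (Finset.subset_univ _) fun s _ _ => h0 s j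
    · obtain ⟨s, hs, hsj⟩ := Finset.exists_lt_of_sum_lt (s := S) (f := fun _ => (0 : ℝ))
        (g := fun s => M s j) (by simpa using hpos)
      rw [← hcol j']
      refine Finset.sum_subset (Finset.subset_univ _) fun s' _ hs' => ?_
      by_contra hne
      have := hmono s s' j j' hsj (lt_of_le_of_ne (h0 s' j') (Ne.symm hne)) (hS s hs s' hs')
      linarith
  have hle := key (Finset.univ.filter (fun a => v a ≤ v s))
    (fun a ha a' ha' => by
      simp only [Finset.mem_filter, Finset.mem_univ, true_and, not_le] at ha ha'
      linarith) j
  have hlt := key (Finset.univ.filter (fun a => v a < v s))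
    (fun a ha a' ha' => by
      simp only [Finset.mem_filter, Finset.mem_univ, true_and, not_lt] at ha ha'
      linarith) j
  have := cumLE_eq_cumLT_add hv (fun a => M a j) s
  rw [cumLE, cumLT, hle, hlt] at this
  rw [corner]
  simp only [cumLE, cumLT] at this ⊢
  linarith

theorem min_add_add_min_sub (r η : ℝ) (m : ℤ)
    (h : η = 0 ∨ ((⌊r⌋ : ℝ) ≤ r - |η| ∧ r + |η| ≤ ⌊r⌋ + 1)) :
    min (r + η) m + min (r - η) m = 2 * min r m := by
  rcases h with rfl | ⟨h₁, h₂⟩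
  · simp
    ring
  · have h₃ := le_abs_self η
    have h₄ := neg_abs_le η
    rcases le_or_gt m ⌊r⌋ with h | h
    · have : (m : ℝ) ≤ ⌊r⌋ := by exact_mod_cast h
      rw [min_eq_right (by linarith), min_eq_right (by linarith), min_eq_right (by linarith)]
      ring
    · have : (⌊r⌋ : ℝ) + 1 ≤ m := by exact_mod_cast h
      rw [min_eq_left (by linarith), min_eq_left (by linarith), min_eq_left (by linarith)]
      ring

section Exchange

variable {n k : ℕ} {b c d : Fin n → ℝ} {p : (Fin n → Fin n → ℝ) × (Fin n → Fin n → ℝ)}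

/-- The two matrices of a point of the LP stacked into one. -/
def stack (p : (Fin n → Fin n → ℝ) × (Fin n → Fin n → ℝ)) : Fin n ⊕ Fin n → Fin n → ℝ :=
  Sum.elim p.1 p.2

/-- The point of the LP given by a stacked matrix. -/
def unstack (M : Fin n ⊕ Fin n → Fin n → ℝ) : (Fin n → Fin n → ℝ) × (Fin n → Fin n → ℝ) :=
  (fun i => M (Sum.inl i), fun i => M (Sum.inr i))

theorem unstack_mem_Pk {M : Fin n ⊕ Fin n → Fin n → ℝ} (h0 : ∀ s j, 0 ≤ M s j)
    (hcol : ∀ j, ∑ s, M s j = 1)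
    (hrow : ∀ i, ∑ j, M (Sum.inl i) j + ∑ j, M (Sum.inr i) j = 1)
    (hk : ∑ i, ∑ j, M (Sum.inl i) j ≤ k) : unstack M ∈ Pk n k := by
  refine ⟨fun i j => h0 _ _, fun i j => h0 _ _, fun j => ?_, fun i => ?_, hk⟩
  · rw [Finset.sum_add_distrib, ← hcol j, Fintype.sum_sum_type]
    rfl
  · rw [Finset.sum_add_distrib, ← hrow i]
    rfl

theorem obj_unstack (M : Fin n ⊕ Fin n → Fin n → ℝ) :
    obj b c d (unstack M) = ∑ s, ∑ j, Sum.elim b c s * M s j * d j := by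
  rw [Fintype.sum_sum_type, ← Finset.sum_add_distrib]
  refine Finset.sum_congr rfl fun i _ => ?_
  rw [← Finset.sum_add_distrib]
  refine Finset.sum_congr rfl fun j _ => ?_
  simp only [unstack, Sum.elim_inl, Sum.elim_inr]
  ring

theorem unstack_stack : unstack (stack p) = p := rfl

theorem stack_nonneg (hp : p ∈ Pk n k) (s : Fin n ⊕ Fin n) (j : Fin n) : 0 ≤ stack p s j := by
  cases s
  · exact hp.1 _ _
  · exact hp.2.1 _ _

theorem sum_stack_col (hp : p ∈ Pk n k) (j : Fin n) : ∑ s, stack p s j = 1 := by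
  rw [← hp.2.2.1 j, Finset.sum_add_distrib, Fintype.sum_sum_type]
  rfl

theorem sum_stack_row (hp : p ∈ Pk n k) (i : Fin n) :
    ∑ j, stack p (Sum.inl i) j + ∑ j, stack p (Sum.inr i) j = 1 := by
  rw [← hp.2.2.2.1 i, Finset.sum_add_distrib]
  rfl

theorem direction_cost_nonneg (hp : p ∈ Pk n k)
    (hopt : ∀ q ∈ Pk n k, obj b c d p ≤ obj b c d q) (D : Fin n ⊕ Fin n → Fin n → ℝ)
    (hcol : ∀ j, ∑ s, D s j = 0)
    (hrow : ∀ i, ∑ j, D (Sum.inl i) j + ∑ j, D (Sum.inr i) j = 0)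
    (hk : ∑ i, ∑ j, D (Sum.inl i) j = 0) (hD : ∀ s j, D s j < 0 → 0 < stack p s j) :
    0 ≤ ∑ s, ∑ j, Sum.elim b c s * D s j * d j := by
  have hev : ∀ᶠ ε : ℝ in nhdsWithin 0 (Set.Ioi 0), ∀ s j, 0 ≤ stack p s j + ε * D s j := by
    refine Filter.eventually_all.2 fun s => Filter.eventually_all.2 fun j => ?_
    rcases lt_or_ge (D s j) 0 with h | h
    · have hcont : Filter.Tendsto (fun ε : ℝ => stack p s j + ε * D s j)
          (nhdsWithin 0 (Set.Ioi 0)) (nhds (stack p s j + 0 * D s j)) :=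
        (Continuous.tendsto (by fun_prop) 0).mono_left nhdsWithin_le_nhds
      exact (hcont.eventually_const_lt (by simpa using hD s j h)).mono fun _ => le_of_lt
    · filter_upwards [self_mem_nhdsWithin] with ε hε
      exact add_nonneg (stack_nonneg hp s j) (mul_nonneg (le_of_lt hε) h)
  obtain ⟨ε, hε, hpos⟩ := (hev.and self_mem_nhdsWithin).exists
  have hpos : 0 < ε := hpos
  have hq : unstack (fun s j => stack p s j + ε * D s j) ∈ Pk n k := by
    refine unstack_mem_Pk hε (fun j => ?_) (fun i => ?_) ?_
    · rw [Finset.sum_add_distrib, ← Finset.mul_sum, hcol, sum_stack_col hp]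
      simp
    · simp only [Finset.sum_add_distrib, ← Finset.mul_sum]
      linear_combination sum_stack_row hp i + ε * hrow i
    · simp only [Finset.sum_add_distrib, ← Finset.mul_sum, hk]
      simpa [stack] using hp.2.2.2.2
  have hobj := hopt _ hq
  rw [← unstack_stack (p := p), obj_unstack, obj_unstack, unstack_stack] at hobj
  have hsplit : ∑ s, ∑ j, Sum.elim b c s * (stack p s j + ε * D s j) * d j =
      ∑ s, ∑ j, Sum.elim b c s * stack p s j * d j +
        ε * ∑ s, ∑ j, Sum.elim b c s * D s j * d j := by
    simp only [Finset.mul_sum, ← Finset.sum_add_distrib]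
    exact Finset.sum_congr rfl fun s _ => Finset.sum_congr rfl fun j _ => by ring
  rw [hsplit] at hobj
  exact nonneg_of_mul_nonneg_right (by linarith) hpos

theorem exchange_cost_nonneg (hp : p ∈ Pk n k)
    (hopt : ∀ q ∈ Pk n k, obj b c d p ≤ obj b c d q) {s s' t t' : Fin n ⊕ Fin n} {j l : Fin n}
    (hsj : 0 < stack p s j) (hsl : 0 < stack p s' l)
    (hrow : ∀ f : Fin n ⊕ Fin n → ℝ,
      (∀ i i', f (Sum.inl i) - f (Sum.inr i) = f (Sum.inl i') - f (Sum.inr i')) →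
        f s + f s' = f t + f t') :
    Sum.elim b c s * d j + Sum.elim b c s' * d l ≤
      Sum.elim b c t * d j + Sum.elim b c t' * d l := by
  let E : Fin n ⊕ Fin n → Fin n → Fin n ⊕ Fin n → Fin n → ℝ :=
    fun a x a' x' => if a' = a then if x' = x then 1 else 0 else 0
  have hcolE : ∀ a x x', ∑ a', E a x a' x' = if x' = x then 1 else 0 := by
    intro a x x'
    simp [E]
  have hrowE : ∀ a x a', ∑ x', E a x a' x' = if a' = a then 1 else 0 := by
    intro a x a'
    by_cases h : a' = a <;> simp [E, h]
  have hcostE : ∀ a x, ∑ a', ∑ x', Sum.elim b c a' * E a x a' x' * d x' =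
      Sum.elim b c a * d x := by
    intro a x
    rw [Finset.sum_eq_single a (fun a' _ h => by simp [E, h]) (by simp)]
    simp [E]
  have hD := direction_cost_nonneg hp hopt
    (fun a x => E t j a x + E t' l a x - E s j a x - E s' l a x) ?_ ?_ ?_ ?_
  · have hsplit : ∑ a, ∑ x, Sum.elim b c a *
        (E t j a x + E t' l a x - E s j a x - E s' l a x) * d x =
        Sum.elim b c t * d j + Sum.elim b c t' * d l - Sum.elim b c s * d j -
          Sum.elim b c s' * d l := by
      simp only [← hcostE, ← Finset.sum_add_distrib, ← Finset.sum_sub_distrib]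
      exact Finset.sum_congr rfl fun a _ => Finset.sum_congr rfl fun x _ => by ring
    linarith
  · intro x
    simp only [Finset.sum_sub_distrib, Finset.sum_add_distrib, hcolE]
    ring
  · intro i
    simp only [Finset.sum_sub_distrib, Finset.sum_add_distrib, hrowE]
    have := hrow (fun a => (if Sum.inl i = a then 1 else 0) + (if Sum.inr i = a then 1 else 0))
      (fun i' i'' => by simp)
    linarith
  · simp only [Finset.sum_sub_distrib, Finset.sum_add_distrib, hrowE]
    have := hrow (fun a => ∑ i, if Sum.inl i = a then 1 else 0) (fun i' i'' => by simp)
    linarith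
  · intro a x hneg
    by_cases h₁ : a = s ∧ x = j
    · rw [h₁.1, h₁.2]
      exact hsj
    by_cases h₂ : a = s' ∧ x = l
    · rw [h₂.1, h₂.2]
      exact hsl
    have hE : ∀ a' x', 0 ≤ E a' x' a x := fun a' x' => by
      simp only [E]
      split_ifs <;> norm_num
    have e₁ : E s j a x = 0 := by
      simp only [E]
      split_ifs <;> tauto
    have e₂ : E s' l a x = 0 := by
      simp only [E]
      split_ifs <;> tauto
    have := hE t j
    have := hE t' l
    linarith

theorem demand_le_of_value_lt (hp : p ∈ Pk n k)
    (hopt : ∀ q ∈ Pk n k, obj b c d p ≤ obj b c d q) {s s' : Fin n ⊕ Fin n} {j j' : Fin n}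
    (hs : 0 < stack p s j) (hs' : 0 < stack p s' j')
    (hlt : Sum.elim b c s < Sum.elim b c s') : d j' ≤ d j := by
  have := exchange_cost_nonneg hp hopt (t := s') (t' := s) hs hs' fun f _ => add_comm _ _
  by_contra! h
  nlinarith [mul_pos (sub_pos.2 hlt) (sub_pos.2 h)]

theorem exists_stack_pos {s : Fin n ⊕ Fin n} (h : 0 < ∑ j, stack p s j) :
    ∃ j, 0 < stack p s j := by
  obtain ⟨j, -, hj⟩ := Finset.exists_lt_of_sum_lt (s := Finset.univ) (f := fun _ => (0 : ℝ))
    (g := fun j => stack p s j) (by simpa using h)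
  exact ⟨j, hj⟩

theorem not_nested (hp : p ∈ Pk n k) (hopt : ∀ q ∈ Pk n k, obj b c d p ≤ obj b c d q)
    (hbc : ∀ i, b i ≤ c i) (hd : ∀ j, 0 ≤ d j)
    (hbc_distinct : Function.Injective (Sum.elim b c))
    (hd_distinct : Function.Injective d) {i i' : Fin n}
    (hi : 0 < ∑ j, stack p (Sum.inr i) j) (hi' : 0 < ∑ j, stack p (Sum.inl i') j)
    (hb : b i < b i') : c i ≤ c i' := by
  by_contra! hc
  have hzero : ∀ j l, 0 < stack p (Sum.inl i') j → 0 < stack p (Sum.inr i) l →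
      d j = 0 ∧ d l = 0 := by
    intro j l hj hl
    have := exchange_cost_nonneg hp hopt (t := Sum.inl i) (t' := Sum.inr i') hj hl
      fun f hf => by linarith [hf i i']
    simp only [Sum.elim_inl, Sum.elim_inr] at this
    have h₁ := mul_nonneg (sub_pos.2 hb).le (hd j)
    have h₂ := mul_nonneg (sub_pos.2 hc).le (hd l)
    constructor
    · refine (mul_eq_zero.1 (show (b i' - b i) * d j = 0 by linarith)).resolve_left ?_
      exact (sub_pos.2 hb).ne'
    · refine (mul_eq_zero.1 (show (c i - c i') * d l = 0 by linarith)).resolve_left ?_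
      exact (sub_pos.2 hc).ne'
  obtain ⟨j, hj⟩ := exists_stack_pos hi'
  obtain ⟨l, hl⟩ := exists_stack_pos hi
  obtain ⟨hdj, hdl⟩ := hzero j l hj hl
  obtain rfl : l = j := hd_distinct (hdl.trans hdj.symm)
  have hbc' : b i' < c i' := lt_of_le_of_ne (hbc i') fun h => by
    have := hbc_distinct (a₁ := Sum.inl i') (a₂ := Sum.inr i') h
    simp at this
  have hinl : ∀ x, x ≠ l → stack p (Sum.inl i') x = 0 := fun x hx => by
    by_contra hne
    have := (hzero x l (lt_of_le_of_ne (stack_nonneg hp _ _) (Ne.symm hne)) hl).1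
    exact hx (hd_distinct (this.trans hdl.symm))
  have hinr : ∀ x, x ≠ l → stack p (Sum.inr i') x = 0 := fun x hx => by
    by_contra hne
    have := demand_le_of_value_lt hp hopt hj
      (lt_of_le_of_ne (stack_nonneg hp _ _) (Ne.symm hne)) hbc'
    exact hx (hd_distinct (le_antisymm this (hdl.trans_le (hd x))))
  have hrow := sum_stack_row hp i'
  rw [Finset.sum_eq_single l (fun x _ hx => hinl x hx) (by simp),
    Finset.sum_eq_single l (fun x _ hx => hinr x hx) (by simp)] at hrow
  have hcol := sum_stack_col hp l
  have hsub : ∑ s ∈ {Sum.inl i', Sum.inr i', Sum.inr i}, stack p s l ≤ ∑ s, stack p s l :=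
    Finset.sum_le_sum_of_subset_of_nonneg (Finset.subset_univ _)
      fun s _ _ => stack_nonneg hp s l
  have hne : i' ≠ i := by
    rintro rfl
    exact lt_irrefl _ hb
  rw [Finset.sum_insert (by simp), Finset.sum_insert (by simp [hne]),
    Finset.sum_singleton] at hsub
  linarith

end Exchange

section Perturbation

/-- The integers inside the reals. -/
abbrev intSubring : Subring ℝ := (Int.castRingHom ℝ).range

theorem min_mem_intSubring {x y : ℝ} (hx : x ∈ intSubring) (hy : y ∈ intSubring) :
    min x y ∈ intSubring := by
  rcases min_choice x y with h | h <;> rw [h] <;> assumption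

theorem corner_mem_intSubring {α β : Type*} [Fintype α] [Fintype β] {v m : α → ℝ}
    {w μ : β → ℝ} (hm : ∀ a, m a ∈ intSubring) (hμ : ∀ b, μ b ∈ intSubring) (a : α) (b : β) :
    corner v m w μ a b ∈ intSubring := by
  have h₁ : cumLE v m a ∈ intSubring := sum_mem fun _ _ => hm _
  have h₂ : cumLT v m a ∈ intSubring := sum_mem fun _ _ => hm _
  have h₃ : cumLE w μ b ∈ intSubring := sum_mem fun _ _ => hμ _
  have h₄ : cumLT w μ b ∈ intSubring := sum_mem fun _ _ => hμ _
  exact sub_mem (sub_mem (min_mem_intSubring h₁ h₃) (min_mem_intSubring h₁ h₄))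
    (sub_mem (min_mem_intSubring h₂ h₃) (min_mem_intSubring h₂ h₄))

open Classical in
/-- `ε` at the nonintegral reals and `0` at the integers. -/
noncomputable def nonintStep (ε r : ℝ) : ℝ := if r ∈ intSubring then 0 else ε

theorem nonintStep_of_mem {ε r : ℝ} (h : r ∈ intSubring) : nonintStep ε r = 0 := if_pos h

theorem nonintStep_of_notMem {ε r : ℝ} (h : r ∉ intSubring) : nonintStep ε r = ε := if_neg h

theorem nonintStep_eq_or (ε r : ℝ) : nonintStep ε r = 0 ∨ nonintStep ε r = ε := by
  rw [nonintStep]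
  split_ifs <;> simp

theorem nonintStep_congr {ε r s : ℝ} (h : r - s ∈ intSubring) :
    nonintStep ε r = nonintStep ε s := by
  by_cases hs : s ∈ intSubring
  · rw [nonintStep_of_mem hs, nonintStep_of_mem (by simpa using add_mem h hs)]
  · rw [nonintStep_of_notMem hs, nonintStep_of_notMem fun hr => hs (by simpa using sub_mem hr h)]

variable {n k : ℕ} {b c d : Fin n → ℝ} {p : (Fin n → Fin n → ℝ) × (Fin n → Fin n → ℝ)}

/-- Masses of the upgraded and non-upgraded copies of the suppliers when supplier `i` is
upgraded to the extent `z i`. -/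
def nodeMass (z : Fin n → ℝ) : Fin n ⊕ Fin n → ℝ := Sum.elim z fun i => 1 - z i

theorem sum_nodeMass_add (z δ : Fin n → ℝ) (S : Finset (Fin n ⊕ Fin n)) :
    ∑ s ∈ S, nodeMass (fun i => z i + δ i) s =
      ∑ s ∈ S, nodeMass z s + ∑ s ∈ S, Sum.elim δ (fun i => -δ i) s := by
  rw [← Finset.sum_add_distrib]
  refine Finset.sum_congr rfl fun s _ => ?_
  cases s
  · rfl
  · simp only [nodeMass, Sum.elim_inr]
    ring

theorem sum_nodeMass_sub (z δ : Fin n → ℝ) (S : Finset (Fin n ⊕ Fin n)) :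
    ∑ s ∈ S, nodeMass (fun i => z i - δ i) s =
      ∑ s ∈ S, nodeMass z s - ∑ s ∈ S, Sum.elim δ (fun i => -δ i) s := by
  rw [← Finset.sum_sub_distrib]
  refine Finset.sum_congr rfl fun s _ => ?_
  cases s
  · rfl
  · simp only [nodeMass, Sum.elim_inr]
    ring

theorem sum_filter_sum_elim (f g : Fin n → ℝ) (P : ℝ → Prop) [DecidablePred P] :
    ∑ s with P (Sum.elim b c s), Sum.elim f g s =
      ∑ i with P (b i), f i + ∑ i with P (c i), g i := by
  simp only [Finset.sum_filter, Fintype.sum_sum_type, Sum.elim_inl, Sum.elim_inr]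
  rfl

theorem nodeMass_nonneg {z : Fin n → ℝ} (h0 : ∀ i, 0 ≤ z i) (h1 : ∀ i, z i ≤ 1)
    (s : Fin n ⊕ Fin n) : 0 ≤ nodeMass z s := by
  cases s
  · exact h0 _
  · exact sub_nonneg.2 (h1 _)

theorem sum_nodeMass (z : Fin n → ℝ) : ∑ s, nodeMass z s = ∑ _j : Fin n, (1 : ℝ) := by
  rw [Fintype.sum_sum_type, ← Finset.sum_add_distrib]
  simp [nodeMass]

theorem sum_corner_nodeMass (hbc_distinct : Function.Injective (Sum.elim b c))
    (hd_distinct : Function.Injective d) {z : Fin n → ℝ} (h0 : ∀ i, 0 ≤ z i)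
    (h1 : ∀ i, z i ≤ 1) (s : Fin n ⊕ Fin n) :
    ∑ j, corner (Sum.elim b c) (nodeMass z) (fun j => -d j) (fun _ => 1) s j = nodeMass z s :=
  sum_corner_right hbc_distinct (neg_injective.comp hd_distinct) (nodeMass_nonneg h0 h1)
    (sum_nodeMass z) s

theorem unstack_corner_mem_Pk (hbc_distinct : Function.Injective (Sum.elim b c))
    (hd_distinct : Function.Injective d) {z : Fin n → ℝ} (h0 : ∀ i, 0 ≤ z i)
    (h1 : ∀ i, z i ≤ 1) (hk : ∑ i, z i ≤ k) :
    unstack (corner (Sum.elim b c) (nodeMass z) (fun j => -d j) fun _ => 1) ∈ Pk n k := by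
  refine unstack_mem_Pk
    (corner_nonneg (nodeMass_nonneg h0 h1) fun _ => zero_le_one)
    (sum_corner_left hbc_distinct (neg_injective.comp hd_distinct) (fun _ => zero_le_one)
      (sum_nodeMass z)) (fun i => ?_) ?_
  · simp only [sum_corner_nodeMass hbc_distinct hd_distinct h0 h1]
    simp [nodeMass]
  · simp only [sum_corner_nodeMass hbc_distinct hd_distinct h0 h1]
    exact hk

theorem stack_eq_corner (hp : p ∈ Pk n k) (hopt : ∀ q ∈ Pk n k, obj b c d p ≤ obj b c d q)
    (hbc_distinct : Function.Injective (Sum.elim b c)) (hd_distinct : Function.Injective d)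
    (s : Fin n ⊕ Fin n) (j : Fin n) :
    stack p s j = corner (Sum.elim b c) (nodeMass fun i => ∑ j, stack p (Sum.inl i) j)
      (fun j => -d j) (fun _ => 1) s j := by
  have hmass : (nodeMass fun i => ∑ j, stack p (Sum.inl i) j) = fun s => ∑ j, stack p s j := by
    funext s
    cases s with
    | inl i => rfl
    | inr i =>
      simp only [nodeMass, Sum.elim_inr]
      linarith [sum_stack_row hp i]
  rw [hmass]
  exact eq_corner_of_monotone_support _ _ hbc_distinct (neg_injective.comp hd_distinct) _
    (stack_nonneg hp) (sum_stack_col hp)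
    (fun s s' j j' h h' hlt => neg_le_neg (demand_le_of_value_lt hp hopt h h' hlt)) s j

/-- If the intervals `[b i, c i]` of the fractional entries of `z` are pairwise not nested, then
`z` can be perturbed without changing any integral cumulative mass. -/
theorem exists_perturbation (hb : Function.Injective b) (z : Fin n → ℝ)
    (hclean : ∀ i i', z i ∉ intSubring → z i' ∉ intSubring → b i < b i' → c i ≤ c i')
    (hfrac : ∃ i, z i ∉ intSubring) {ε : ℝ} (hε : 0 < ε) :
    ∃ δ : Fin n → ℝ, (∀ i, |δ i| ≤ ε) ∧ (∀ i, z i ∈ intSubring → δ i = 0) ∧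
      (∃ i, δ i ≠ 0) ∧ |∑ i, δ i| ≤ ε ∧ (∑ i, z i ∈ intSubring → ∑ i, δ i = 0) ∧
      ∀ P : ℝ → Prop, (∀ x y, x ≤ y → P y → P x) → ∀ [DecidablePred P],
        |∑ s with P (Sum.elim b c s), Sum.elim δ (fun i => -δ i) s| ≤ ε ∧
        (∑ s with P (Sum.elim b c s), nodeMass z s ∈ intSubring →
          ∑ s with P (Sum.elim b c s), Sum.elim δ (fun i => -δ i) s = 0) := by
  classical
  let F : Finset (Fin n) := Finset.univ.filter fun i => z i ∉ intSubring
  have hF : ∀ i, i ∈ F ↔ z i ∉ intSubring := fun i => by simp [F]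
  let δ : Fin n → ℝ := fun i => if i ∈ F then
    nonintStep ε (∑ i' ∈ F with b i' ≤ b i, z i') - nonintStep ε (∑ i' ∈ F with b i' < b i, z i')
    else 0
  have hδ0 : ∀ i, i ∉ F → δ i = 0 := fun i hi => if_neg hi
  have habs : ∀ r s, |nonintStep ε r - nonintStep ε s| ≤ ε := fun r s => by
    rcases nonintStep_eq_or ε r with h | h <;> rcases nonintStep_eq_or ε s with h' | h' <;>
      rw [h, h'] <;> simp [abs_of_pos hε, hε.le]
  have hstep0 : nonintStep ε 0 = 0 := nonintStep_of_mem (zero_mem _)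
  have hsum : ∀ T ⊆ F, (∀ a ∈ T, ∀ a' ∈ F, b a' ≤ b a → a' ∈ T) →
      ∑ i ∈ T, δ i = nonintStep ε (∑ i ∈ T, z i) := fun T hTF hT => by
    rw [Finset.sum_congr rfl fun i hi => if_pos (hTF hi),
      Finset.sum_sub_of_isLowerSet b hb z (nonintStep ε) F T hTF hT, hstep0, sub_zero]
  have hrestrict : ∀ S : Finset (Fin n), ∑ i ∈ S, δ i = ∑ i ∈ S with i ∈ F, δ i := fun S => by
    rw [Finset.sum_filter]
    exact Finset.sum_congr rfl fun i _ => by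
      split_ifs with h
      · rfl
      · exact hδ0 i h
  have hzint : ∀ S : Finset (Fin n), ∑ i ∈ S, z i - ∑ i ∈ S with i ∈ F, z i ∈ intSubring :=
    fun S => by
      rw [← Finset.sum_filter_add_sum_filter_not S (fun i => i ∈ F), add_sub_cancel_left]
      refine sum_mem fun i hi => ?_
      have := (Finset.mem_filter.1 hi).2
      rwa [hF, not_not] at this
  have hlower : ∀ S : Finset (Fin n), (∀ a ∈ S, ∀ a', a ∈ F → a' ∈ F → b a' ≤ b a → a' ∈ S) →
      ∑ i ∈ S, δ i = nonintStep ε (∑ i ∈ S, z i) := fun S hS => by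
    rw [hrestrict, hsum, nonintStep_congr (hzint S)]
    · exact fun i hi => (Finset.mem_filter.1 hi).2
    · intro a ha a' ha' hle
      rw [Finset.mem_filter] at ha ⊢
      exact ⟨hS a ha.1 a' ha.2 ha' hle, ha'⟩
  have htotal := hlower Finset.univ fun _ _ _ _ _ _ => Finset.mem_univ _
  refine ⟨δ, fun i => ?_, fun i hi => hδ0 i (by simpa [hF] using hi), ?_, ?_, fun h => ?_,
    fun P hP _ => ?_⟩
  · by_cases hi : i ∈ F
    · simp only [δ, if_pos hi]
      exact habs _ _
    · rw [hδ0 i hi, abs_zero]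
      exact hε.le
  · obtain ⟨i, hi, hmin⟩ := Finset.exists_min_image F b (hfrac.imp fun i => (hF i).2)
    refine ⟨i, ?_⟩
    have := hsum {i} (by simpa using hi) fun a ha a' ha' hle => by
      rw [Finset.mem_singleton] at ha ⊢
      subst ha
      exact hb (le_antisymm hle (hmin a' ha'))
    rw [Finset.sum_singleton, Finset.sum_singleton, nonintStep_of_notMem ((hF i).1 hi)] at this
    rw [this]
    exact hε.ne'
  · rw [htotal]
    simpa [hstep0] using habs (∑ i, z i) 0
  · rw [htotal, nonintStep_of_mem h]
  · have hB := hlower (Finset.univ.filter fun i => P (b i)) fun a ha a' _ _ hle => by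
      simp only [Finset.mem_filter, Finset.mem_univ, true_and] at ha ⊢
      exact hP _ _ hle ha
    have hC := hlower (Finset.univ.filter fun i => P (c i)) fun a ha a' haF ha'F hle => by
      simp only [Finset.mem_filter, Finset.mem_univ, true_and] at ha ⊢
      rcases hle.eq_or_lt with h | h
      · rwa [hb h]
      · exact hP _ _ (hclean a' a ((hF a').1 ha'F) ((hF a).1 haF) h) ha
    rw [sum_filter_sum_elim, Finset.sum_neg_distrib, hB, hC, ← sub_eq_add_neg]
    refine ⟨habs _ _, fun h => sub_eq_zero.2 (nonintStep_congr ?_)⟩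
    rw [nodeMass, sum_filter_sum_elim, Finset.sum_sub_distrib] at h
    have hcard : ∑ i with P (c i), (1 : ℝ) ∈ intSubring := sum_mem fun _ _ => one_mem _
    convert sub_mem h hcard using 1
    ring

theorem corner_add_corner {α β : Type*} [Fintype α] [Fintype β] {v m m₁ m₂ : α → ℝ}
    {w μ : β → ℝ} (hμ : ∀ b, μ b ∈ intSubring) (a : α) (b : β) {η η' : ℝ}
    (h₁ : cumLE v m₁ a = cumLE v m a + η) (h₂ : cumLE v m₂ a = cumLE v m a - η)
    (h₁' : cumLT v m₁ a = cumLT v m a + η') (h₂' : cumLT v m₂ a = cumLT v m a - η')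
    (h : η = 0 ∨ ((⌊cumLE v m a⌋ : ℝ) ≤ cumLE v m a - |η| ∧
      cumLE v m a + |η| ≤ ⌊cumLE v m a⌋ + 1))
    (h' : η' = 0 ∨ ((⌊cumLT v m a⌋ : ℝ) ≤ cumLT v m a - |η'| ∧
      cumLT v m a + |η'| ≤ ⌊cumLT v m a⌋ + 1)) :
    corner v m₁ w μ a b + corner v m₂ w μ a b = 2 * corner v m w μ a b := by
  obtain ⟨x, hx⟩ : cumLE w μ b ∈ intSubring := sum_mem fun _ _ => hμ _
  obtain ⟨y, hy⟩ : cumLT w μ b ∈ intSubring := sum_mem fun _ _ => hμ _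
  simp only [eq_intCast] at hx hy
  simp only [corner, ← hx, ← hy, h₁, h₂, h₁', h₂']
  linear_combination min_add_add_min_sub _ _ x h - min_add_add_min_sub _ _ y h -
    min_add_add_min_sub _ _ x h' + min_add_add_min_sub _ _ y h'

theorem eventually_le_sub_floor (r : ℝ) : ∀ᶠ ε in nhdsWithin (0 : ℝ) (Set.Ioi 0),
    r ∉ intSubring → (⌊r⌋ : ℝ) ≤ r - ε ∧ r + ε ≤ ⌊r⌋ + 1 := by
  by_cases hr : r ∈ intSubring
  · exact Filter.Eventually.of_forall fun ε h => absurd hr h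
  · have hpos : (⌊r⌋ : ℝ) < r := lt_of_le_of_ne (Int.floor_le r) fun h => hr ⟨⌊r⌋, by simpa using h⟩
    filter_upwards [nhdsWithin_le_nhds (eventually_le_nhds (sub_pos.2 hpos)),
      nhdsWithin_le_nhds (eventually_le_nhds (sub_pos.2 (Int.lt_floor_add_one r)))] with ε h h' _
    constructor <;> linarith

theorem upgrade_mem_intSubring (hbc : ∀ i, b i ≤ c i) (hd : ∀ j, 0 ≤ d j)
    (hbc_distinct : Function.Injective (Sum.elim b c)) (hd_distinct : Function.Injective d)
    (hext : p ∈ Set.extremePoints ℝ (Pk n k))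
    (hopt : ∀ q ∈ Pk n k, obj b c d p ≤ obj b c d q) (i : Fin n) :
    ∑ j, stack p (Sum.inl i) j ∈ intSubring := by
  have hp := hext.1
  by_contra hi
  set z : Fin n → ℝ := fun i => ∑ j, stack p (Sum.inl i) j with hz
  have hz0 : ∀ i, 0 ≤ z i := fun i => Finset.sum_nonneg fun j _ => stack_nonneg hp _ _
  have hz1' : ∀ i, ∑ j, stack p (Sum.inr i) j = 1 - z i := fun i => by
    linarith [sum_stack_row hp i]
  have hz1 : ∀ i, z i ≤ 1 := fun i => by
    have : 0 ≤ ∑ j, stack p (Sum.inr i) j := Finset.sum_nonneg fun j _ => stack_nonneg hp _ _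
    linarith [hz1' i]
  have hzk : ∑ i, z i ≤ k := hp.2.2.2.2
  have hzlt : ∀ i, z i ∉ intSubring → 0 < z i ∧ z i < 1 := fun i h =>
    ⟨lt_of_le_of_ne (hz0 i) fun h' => h (h' ▸ zero_mem _),
      lt_of_le_of_ne (hz1 i) fun h' => h (h' ▸ one_mem _)⟩
  have hclean : ∀ i i', z i ∉ intSubring → z i' ∉ intSubring → b i < b i' → c i ≤ c i' :=
    fun i i' h h' => not_nested hp hopt hbc hd hbc_distinct hd_distinct
      (by rw [hz1']; linarith [(hzlt i h).2]) (hzlt i' h').1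
  have hεz : ∀ᶠ ε in nhdsWithin (0 : ℝ) (Set.Ioi 0), ∀ i, z i ∉ intSubring →
      ε ≤ z i ∧ z i + ε ≤ 1 := by
    refine Filter.eventually_all.2 fun i => ?_
    by_cases h : z i ∈ intSubring
    · exact Filter.Eventually.of_forall fun ε h' => absurd h h'
    · filter_upwards [nhdsWithin_le_nhds (eventually_le_nhds (hzlt i h).1),
        nhdsWithin_le_nhds (eventually_le_nhds (sub_pos.2 (hzlt i h).2))] with ε h h' _
      exact ⟨h, by linarith⟩
  have hεk : ∀ᶠ ε in nhdsWithin (0 : ℝ) (Set.Ioi 0), ∑ i, z i < k → ∑ i, z i + ε ≤ k := by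
    by_cases h : ∑ i, z i < k
    · filter_upwards [nhdsWithin_le_nhds (eventually_le_nhds (sub_pos.2 h))] with ε h _
      linarith
    · exact Filter.Eventually.of_forall fun ε h' => absurd h' h
  have hεLE := Filter.eventually_all.2 fun s =>
    eventually_le_sub_floor (cumLE (Sum.elim b c) (nodeMass z) s)
  have hεLT := Filter.eventually_all.2 fun s =>
    eventually_le_sub_floor (cumLT (Sum.elim b c) (nodeMass z) s)
  obtain ⟨ε, hεz, hεk, hεLE, hεLT, hε⟩ :=
    (hεz.and (hεk.and (hεLE.and (hεLT.and self_mem_nhdsWithin)))).exists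
  obtain ⟨δ, hδ, hδ0, ⟨i₀, hi₀⟩, hδk, hδk0, hcum⟩ := exists_perturbation (b := b)
    (c := c) (fun i i' h => Sum.inl_injective (hbc_distinct (a₁ := Sum.inl i) (a₂ := Sum.inl i') h))
    z hclean ⟨i, hi⟩ hε
  have hbound : ∀ i, 0 ≤ z i + δ i ∧ z i + δ i ≤ 1 ∧ 0 ≤ z i - δ i ∧ z i - δ i ≤ 1 := fun i => by
    by_cases h : z i ∈ intSubring
    · rw [hδ0 i h]
      simp [hz0, hz1]
    · have := abs_le.1 (hδ i)
      have := hεz i h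
      refine ⟨?_, ?_, ?_, ?_⟩ <;> linarith
  have hbudget : ∑ i, z i + ∑ i, δ i ≤ k ∧ ∑ i, z i - ∑ i, δ i ≤ k := by
    rcases hzk.eq_or_lt with h | h
    · rw [hδk0 (h ▸ natCast_mem _ _)]
      simp [hzk]
    · have := abs_le.1 hδk
      have := hεk h
      constructor <;> linarith
  have hadd := unstack_corner_mem_Pk (k := k) hbc_distinct hd_distinct
    (z := fun i => z i + δ i) (fun i => (hbound i).1) (fun i => (hbound i).2.1)
    (by rw [Finset.sum_add_distrib]; exact hbudget.1)
  have hsub := unstack_corner_mem_Pk (k := k) hbc_distinct hd_distinct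
    (z := fun i => z i - δ i) (fun i => (hbound i).2.2.1) (fun i => (hbound i).2.2.2)
    (by rw [Finset.sum_sub_distrib]; exact hbudget.2)
  have hmid : ∀ s j,
      corner (Sum.elim b c) (nodeMass fun i => z i + δ i) (fun j => -d j) (fun _ => 1) s j +
        corner (Sum.elim b c) (nodeMass fun i => z i - δ i) (fun j => -d j) (fun _ => 1) s j =
      2 * stack p s j := fun s j => by
    obtain ⟨hle, hle0⟩ := hcum (fun x => x ≤ Sum.elim b c s) fun x y hxy hy => hxy.trans hy
    obtain ⟨hlt, hlt0⟩ := hcum (fun x => x < Sum.elim b c s) fun x y hxy hy => hxy.trans_lt hy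
    rw [stack_eq_corner hp hopt hbc_distinct hd_distinct]
    change _ = 2 * corner _ (nodeMass z) _ _ s j
    refine corner_add_corner (fun _ => one_mem _) s j (sum_nodeMass_add z δ _)
      (sum_nodeMass_sub z δ _) (sum_nodeMass_add z δ _) (sum_nodeMass_sub z δ _) ?_ ?_
    · by_cases h : cumLE (Sum.elim b c) (nodeMass z) s ∈ intSubring
      · exact Or.inl (hle0 h)
      · have := hεLE s h
        right
        constructor <;> linarith
    · by_cases h : cumLT (Sum.elim b c) (nodeMass z) s ∈ intSubring
      · exact Or.inl (hlt0 h)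
      · have := hεLT s h
        right
        constructor <;> linarith
  have hseg : p ∈ openSegment ℝ
      (unstack (corner (Sum.elim b c) (nodeMass fun i => z i + δ i) (fun j => -d j) fun _ => 1))
      (unstack (corner (Sum.elim b c) (nodeMass fun i => z i - δ i) (fun j => -d j) fun _ => 1)) := by
    refine ⟨1 / 2, 1 / 2, by norm_num, by norm_num, by norm_num, Prod.ext ?_ ?_⟩
    · funext i j
      have := hmid (Sum.inl i) j
      simp only [stack, Sum.elim_inl] at this
      simp only [unstack, Prod.fst_add, Prod.smul_fst, Pi.add_apply, Pi.smul_apply, smul_eq_mul]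
      linarith
    · funext i j
      have := hmid (Sum.inr i) j
      simp only [stack, Sum.elim_inr] at this
      simp only [unstack, Prod.snd_add, Prod.smul_snd, Pi.add_apply, Pi.smul_apply, smul_eq_mul]
      linarith
  have heq := hext.2 hadd hsub hseg
  have hrow := sum_corner_nodeMass hbc_distinct hd_distinct (z := fun i => z i + δ i)
    (fun i => (hbound i).1) (fun i => (hbound i).2.1) (Sum.inl i₀)
  have hrow' : ∑ j, stack p (Sum.inl i₀) j = z i₀ + δ i₀ := by
    rw [← heq]
    exact hrow
  exact hi₀ (by simpa [hz] using hrow')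

end Perturbation

/-- if all the values `b i`, `c i` are pairwise distinct and the
demands are pairwise distinct, then every optimal extreme point of `P(k)`
is integral. -/
theorem stmt2 (n : ℕ) (hn : 1 ≤ n) (b c d : Fin n → ℝ)
    (hb : ∀ i, 0 ≤ b i) (hbc : ∀ i, b i ≤ c i) (hd : ∀ j, 0 ≤ d j)
    (hbc_distinct : Function.Injective (Sum.elim b c))
    (hd_distinct : Function.Injective d) (k : ℕ)
    (p : (Fin n → Fin n → ℝ) × (Fin n → Fin n → ℝ))
    (hext : p ∈ Set.extremePoints ℝ (Pk n k))
    (hopt : ∀ q ∈ Pk n k, obj b c d p ≤ obj b c d q) :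
    Integral p := by
  have hp := hext.1
  have hzero_or_one : ∀ s j, stack p s j = 0 ∨ stack p s j = 1 := fun s j => by
    have hmem : stack p s j ∈ intSubring := by
      rw [stack_eq_corner hp hopt hbc_distinct hd_distinct]
      refine corner_mem_intSubring (fun s => ?_) (fun _ => one_mem _) s j
      have hz := upgrade_mem_intSubring hbc hd hbc_distinct hd_distinct hext hopt
      cases s with
      | inl i => exact hz i
      | inr i => exact sub_mem (one_mem _) (hz i)
    have h0 := stack_nonneg hp s j
    have h1 : stack p s j ≤ 1 := by
      rw [← sum_stack_col hp j]
      exact Finset.single_le_sum (f := fun s => stack p s j)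
        (fun s _ => stack_nonneg hp s j) (Finset.mem_univ s)
    obtain ⟨m, hm⟩ := hmem
    rw [← hm, eq_intCast] at h0 h1 ⊢
    have hm0 : 0 ≤ m := by exact_mod_cast h0
    have hm1 : m ≤ 1 := by exact_mod_cast h1
    interval_cases m <;> simp
  exact ⟨fun i j => hzero_or_one (Sum.inl i) j, fun i j => hzero_or_one (Sum.inr i) j⟩
end

section
/- Redistribution lemma: let (A, B) be a clean optimal pair and let (A', B') be a redistribution of (A, B). Then |A| < |A'| ≤ |B'| < |B| and cost(A') + cost(B') ≤ cost(A) + cost(B). -/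
open Finset

/-- An alternating sum of a nonnegative antitone sequence lies between `0` and any upper bound
of the sequence. -/
theorem alternating_sum_mem_Icc : ∀ (ℓ : ℕ) (h : Fin ℓ → ℤ) (M : ℤ), Antitone h →
    (∀ s, 0 ≤ h s) → (∀ s, h s ≤ M) → 0 ≤ M →
    0 ≤ ∑ s : Fin ℓ, (-1) ^ (s : ℕ) * h s ∧ ∑ s : Fin ℓ, (-1) ^ (s : ℕ) * h s ≤ M
  | 0, _, _, _, _, _, hM => by simpa using hM
  | ℓ + 1, h, M, hanti, h0, hle, _ => by
    have ih := alternating_sum_mem_Icc ℓ (fun s => h s.succ) (h 0)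
      (fun s t hst => hanti (Fin.succ_le_succ_iff.2 hst)) (fun s => h0 _)
      (fun s => hanti (Fin.zero_le _)) (h0 _)
    have hsum : ∑ s : Fin (ℓ + 1), (-1) ^ (s : ℕ) * h s =
        h 0 - ∑ s : Fin ℓ, (-1) ^ (s : ℕ) * h s.succ := by
      rw [Fin.sum_univ_succ, sub_eq_add_neg, ← Finset.sum_neg_distrib]
      simp [pow_succ]
    have := hle 0
    rw [hsum]
    constructor <;> linarith [ih.1, ih.2]

/-- If every sublevel set of `v` has at most one element more than that of `u`, then each value of
the monotone sequence `u` is at most every later value of the monotone sequence `v`. -/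
theorem le_of_card_sublevel_le {n : ℕ} {u v : Fin n → ℝ} (hu : Monotone u) (hv : Monotone v)
    (h : ∀ t, #{i | v i ≤ t} ≤ #{i | u i ≤ t} + 1) {r s : Fin n} (hrs : r < s) : u r ≤ v s := by
  by_contra! hlt
  have h1 : #(Finset.Iic s) ≤ #{i | v i ≤ v s} :=
    Finset.card_le_card fun i hi => by simpa using hv (Finset.mem_Iic.1 hi)
  have h2 : #{i | u i ≤ v s} ≤ #(Finset.Iio r) :=
    Finset.card_le_card fun i hi => by
      simp only [Finset.mem_filter, Finset.mem_univ, true_and, Finset.mem_Iio] at hi ⊢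
      by_contra! hri
      exact absurd (hu hri) (not_le.2 (hi.trans_lt hlt))
  have h3 := h (v s)
  rw [Fin.card_Iic] at h1
  rw [Fin.card_Iio] at h2
  have : (r : ℕ) < s := hrs
  omega

theorem card_sublevel_comp_perm {n : ℕ} (f : Fin n → ℝ) (σ : Equiv.Perm (Fin n)) (t : ℝ) :
    #{i | f (σ i) ≤ t} = #{i | f i ≤ t} :=
  Finset.card_equiv σ (by simp)

/-- Two cost vectors whose sublevel sets have almost equal sizes can both be assigned to the
customers such that jointly all `2 n` costs are ordered oppositely to the demands. -/
theorem exists_perm_antivary_s6 {n : ℕ} (f : Bool → Fin n → ℝ) (d : Fin n → ℝ)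
    (h : ∀ x y t, #{i | f x i ≤ t} ≤ #{i | f y i ≤ t} + 1) :
    ∃ π : Bool → Equiv.Perm (Fin n),
      Antivary (fun p : Bool × Fin n => f p.1 (π p.1 p.2)) (fun p => d p.2) := by
  let δ := Tuple.sort (fun j => -d j)
  have hδ : Monotone ((fun j => -d j) ∘ δ) := Tuple.monotone_sort _
  refine ⟨fun x => δ.symm.trans (Tuple.sort (f x)), ?_⟩
  rintro ⟨x, i⟩ ⟨y, j⟩ hij
  have hlt : δ.symm j < δ.symm i := by
    by_contra! hle
    have := hδ hle
    simp only [Function.comp_apply, Equiv.apply_symm_apply] at this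
    simp only at hij
    linarith
  refine le_of_card_sublevel_le (Tuple.monotone_sort (f y)) (Tuple.monotone_sort (f x))
    (fun t => ?_) hlt
  have h1 := card_sublevel_comp_perm (f x) (Tuple.sort (f x)) t
  have h2 := card_sublevel_comp_perm (f y) (Tuple.sort (f y)) t
  have h3 := h x y t
  simp only [Function.comp_apply]
  omega

/-- The cost of supplier `i` when the suppliers in `A` are upgraded. -/
def effCost {n : ℕ} (b c : Fin n → ℝ) (A : Finset (Fin n)) (i : Fin n) : ℝ :=
  if i ∈ A then b i else c i

theorem exists_assignCost_eq_cost {n : ℕ} (b c d : Fin n → ℝ) (A : Finset (Fin n)) :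
    ∃ π, assignCost b c d A π = cost b c d A := by
  obtain ⟨π, -, hπ⟩ := Finset.exists_mem_eq_inf' Finset.univ_nonempty (assignCost b c d A)
  exact ⟨π, hπ.symm⟩

/-- If `(A', B')` arises from `(A, B)` by exchanging memberships between the two sets and the
effective costs for `A'` and `B'` are balanced, then the total cost does not increase. -/
theorem cost_add_cost_le {n : ℕ} (b c d : Fin n → ℝ) (A B A' B' : Finset (Fin n))
    (hex : ∀ i, ((i ∈ A ↔ i ∈ A') ∧ (i ∈ B ↔ i ∈ B')) ∨ ((i ∈ A ↔ i ∈ B') ∧ (i ∈ B ↔ i ∈ A')))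
    (hAB : ∀ t, #{i | effCost b c A' i ≤ t} ≤ #{i | effCost b c B' i ≤ t} + 1)
    (hBA : ∀ t, #{i | effCost b c B' i ≤ t} ≤ #{i | effCost b c A' i ≤ t} + 1) :
    cost b c d A' + cost b c d B' ≤ cost b c d A + cost b c d B := by
  classical
  let F : Bool → Fin n → ℝ := fun x => effCost b c (if x then B' else A')
  obtain ⟨π, hπ⟩ := exists_perm_antivary_s6 F d (by
    rintro (_ | _) (_ | _) t
    · simp
    · simpa [F] using hAB t
    · simpa [F] using hBA t
    · simp)
  obtain ⟨α, hα⟩ := exists_assignCost_eq_cost b c d A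
  obtain ⟨β, hβ⟩ := exists_assignCost_eq_cost b c d B
  let γ : Bool → Equiv.Perm (Fin n) := fun x => if x then β else α
  let flip : Bool × Fin n → Bool × Fin n := fun p =>
    if (p.2 ∈ A ↔ p.2 ∈ A') ∧ (p.2 ∈ B ↔ p.2 ∈ B') then p else (!p.1, p.2)
  have hflip : Function.Involutive flip := by
    rintro ⟨x, i⟩
    by_cases hi : (i ∈ A ↔ i ∈ A') ∧ (i ∈ B ↔ i ∈ B') <;> simp [flip, hi]
  let τ : Equiv.Perm (Bool × Fin n) :=
    ((Equiv.prodShear (Equiv.refl Bool) γ).trans hflip.toPerm).trans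
      (Equiv.prodShear (Equiv.refl Bool) π).symm
  have hτ : ∀ p, F (τ p).1 (π (τ p).1 (τ p).2) =
      effCost b c (if p.1 then B else A) (γ p.1 p.2) := by
    intro p
    have hp : Equiv.prodShear (Equiv.refl Bool) π (τ p) = flip (p.1, γ p.1 p.2) := by
      simp only [τ, Equiv.trans_apply, Equiv.apply_symm_apply]
      rfl
    have h1 : (τ p).1 = (flip (p.1, γ p.1 p.2)).1 := by
      have := congrArg Prod.fst hp
      exact this
    have h2 : π (τ p).1 (τ p).2 = (flip (p.1, γ p.1 p.2)).2 := congrArg Prod.snd hp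
    rw [h2, h1]
    generalize γ p.1 p.2 = i
    by_cases hi : (i ∈ A ↔ i ∈ A') ∧ (i ∈ B ↔ i ∈ B')
    · rcases p with ⟨_ | _, j⟩ <;> simp [flip, F, effCost, hi]
    · have hi' := (hex i).resolve_left hi
      have hfi : ∀ x, flip (x, i) = (!x, i) := fun x => if_neg hi
      rcases p with ⟨_ | _, j⟩ <;> simp [hfi, F, effCost, hi']
  have key := hπ.sum_mul_le_sum_comp_perm_mul (σ := τ)
  simp only [hτ, Fintype.sum_prod_type, Fintype.sum_bool] at key
  have hA' : cost b c d A' ≤ assignCost b c d A' (π false) := Finset.inf'_le _ (Finset.mem_univ _)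
  have hB' : cost b c d B' ≤ assignCost b c d B' (π true) := Finset.inf'_le _ (Finset.mem_univ _)
  rw [← hα, ← hβ]
  simp only [F, γ, effCost, if_true, Bool.false_eq_true, if_false] at key
  simp only [assignCost] at hA' hB' ⊢
  linarith

/-- Distributing the members of an enumeration alternately to two sets yields almost equally many
members for each of them. -/
theorem card_odd_even (ℓ : ℕ) :
    #{s : Fin ℓ | (s : ℕ) % 2 = 1} ≤ #{s : Fin ℓ | (s : ℕ) % 2 = 0} ∧
    #{s : Fin ℓ | (s : ℕ) % 2 = 0} ≤ #{s : Fin ℓ | (s : ℕ) % 2 = 1} + 1 ∧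
    #{s : Fin ℓ | (s : ℕ) % 2 = 0} + #{s : Fin ℓ | (s : ℕ) % 2 = 1} = ℓ := by
  have halt := alternating_sum_mem_Icc ℓ (fun _ => 1) 1 (fun _ _ _ => le_rfl) (by simp) (by simp)
    zero_le_one
  have hsum : ∑ s : Fin ℓ, (-1 : ℤ) ^ (s : ℕ) * 1 =
      #{s : Fin ℓ | (s : ℕ) % 2 = 0} - #{s : Fin ℓ | (s : ℕ) % 2 = 1} := by
    rw [← Finset.sum_boole, ← Finset.sum_boole, ← Finset.sum_sub_distrib]
    refine Finset.sum_congr rfl fun s _ => ?_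
    rcases Nat.mod_two_eq_zero_or_one (s : ℕ) with hs | hs
    · simp [hs, (Nat.even_iff.2 hs).neg_one_pow]
    · simp [hs, (Nat.odd_iff.2 hs).neg_one_pow]
  have hadd : #{s : Fin ℓ | (s : ℕ) % 2 = 0} + #{s : Fin ℓ | (s : ℕ) % 2 = 1} = ℓ := by
    have := Finset.card_filter_add_card_filter_not (s := (Finset.univ : Finset (Fin ℓ)))
      (fun s => (s : ℕ) % 2 = 0)
    simpa using this
  rw [hsum] at halt
  omega

theorem abs_card_sublevel_sub_le {n ℓ : ℕ} (b c : Fin n → ℝ) (A B : Finset (Fin n))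
    (e : Fin ℓ → Fin n) (he : Function.Injective e) (hbe : Monotone (b ∘ e))
    (hce : Monotone (c ∘ e)) (hA : ∀ s, e s ∈ A ↔ (s : ℕ) % 2 = 1)
    (hB : ∀ s, e s ∈ B ↔ (s : ℕ) % 2 = 0) (hAB : ∀ i, (∀ s, e s ≠ i) → (i ∈ A ↔ i ∈ B)) (t : ℝ) :
    |(#{i | effCost b c B i ≤ t} : ℤ) - #{i | effCost b c A i ≤ t}| ≤ 1 := by
  have halt : ∀ g : Fin n → ℝ, Monotone (g ∘ e) →
      0 ≤ ∑ s : Fin ℓ, (-1 : ℤ) ^ (s : ℕ) * (if g (e s) ≤ t then 1 else 0) ∧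
      ∑ s : Fin ℓ, (-1 : ℤ) ^ (s : ℕ) * (if g (e s) ≤ t then 1 else 0) ≤ 1 := by
    intro g hg
    refine alternating_sum_mem_Icc ℓ (fun s => if g (e s) ≤ t then 1 else 0) 1 ?_ ?_ ?_ zero_le_one
    · intro r s hrs
      have : g (e r) ≤ g (e s) := hg hrs
      simp only
      split_ifs with h1 h2
      · rfl
      · exact absurd (this.trans h1) h2
      · simp
      · rfl
    · intro s
      split_ifs <;> simp
    · intro s
      split_ifs <;> simp
  have hsum : (#{i | effCost b c B i ≤ t} : ℤ) - #{i | effCost b c A i ≤ t} =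
      ∑ s : Fin ℓ, (-1 : ℤ) ^ (s : ℕ) * (if b (e s) ≤ t then 1 else 0) -
        ∑ s : Fin ℓ, (-1 : ℤ) ^ (s : ℕ) * (if c (e s) ≤ t then 1 else 0) := by
    rw [← Finset.sum_boole, ← Finset.sum_boole, ← Finset.sum_sub_distrib,
      ← Finset.sum_sub_distrib]
    symm
    refine Finset.sum_of_injOn e he.injOn (by simp) ?_ ?_
    · intro i _ hi
      have : effCost b c A i = effCost b c B i := by
        simp [effCost, hAB i fun s hs => hi ⟨s, by simp, hs⟩]
      simp [this]
    · intro s _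
      rcases Nat.mod_two_eq_zero_or_one (s : ℕ) with hs | hs
      · simp [effCost, hA, hB, hs, (Nat.even_iff.2 hs).neg_one_pow]
      · simp only [effCost, hA, hB, hs, (Nat.odd_iff.2 hs).neg_one_pow]
        split_ifs <;> simp_all
  rw [hsum, abs_le]
  have h1 := halt b hbe
  have h2 := halt c hce
  constructor <;> linarith [h1.1, h1.2, h2.1, h2.2]

/-- redistribution lemma: a redistribution of a clean optimal
pair is more balanced and has at most the same total cost. -/
theorem stmt6 (n : ℕ) (hn : 1 ≤ n) (b c d : Fin n → ℝ)
    (hb : ∀ i, 0 ≤ b i) (hbc : ∀ i, b i ≤ c i) (hd : ∀ j, 0 ≤ d j) (k : ℕ)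
    (A B A' B' : Finset (Fin n))
    (hopt : OptimalPair b c d k A B) (hclean : Clean b c A B)
    (hred : Redistribution b c A B A' B') :
    A.card < A'.card ∧ A'.card ≤ B'.card ∧ B'.card < B.card ∧
      cost b c d A' + cost b c d B' ≤ cost b c d A + cost b c d B := by
  obtain ⟨hAk, hkB, -⟩ := hopt
  obtain ⟨ℓ, e, he, himg, hbe, hce, rfl, rfl⟩ := hred
  have hmem : ∀ s, e s ∈ symmDiff A B := fun s => himg ▸ Finset.mem_image_of_mem e (by simp)
  have hnot : ∀ s, e s ∉ A ∩ B := fun s hs => by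
    have := hmem s
    simp only [Finset.mem_symmDiff, Finset.mem_inter] at this hs
    tauto
  have hdisj : ∀ S : Finset (Fin ℓ), Disjoint (A ∩ B) (S.image e) := fun S => by
    rw [Finset.disjoint_right]
    intro i hi
    obtain ⟨s, -, rfl⟩ := Finset.mem_image.1 hi
    exact hnot s
  have hcard : (symmDiff A B).card = ℓ := by
    rw [← himg, Finset.card_image_of_injective _ he, Finset.card_univ, Fintype.card_fin]
  rw [symmDiff, Finset.sup_eq_union, Finset.card_union_of_disjoint disjoint_sdiff_sdiff] at hcard
  have hA := Finset.card_inter_add_card_sdiff A B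
  have hB := Finset.card_inter_add_card_sdiff B A
  rw [Finset.inter_comm] at hB
  have hℓ := card_odd_even ℓ
  have hodd : ∀ s, e s ∈ (A ∩ B) ∪ Finset.image e {s : Fin ℓ | (s : ℕ) % 2 = 1} ↔
      (s : ℕ) % 2 = 1 := fun s => by
    rw [Finset.mem_union, or_iff_right (hnot s), he.mem_finset_image]
    simp
  have heven : ∀ s, e s ∈ (A ∩ B) ∪ Finset.image e {s : Fin ℓ | (s : ℕ) % 2 = 0} ↔
      (s : ℕ) % 2 = 0 := fun s => by
    rw [Finset.mem_union, or_iff_right (hnot s), he.mem_finset_image]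
    simp
  have hout : ∀ (S : Finset (Fin ℓ)) (i : Fin n), (∀ s, e s ≠ i) →
      (i ∈ (A ∩ B) ∪ S.image e ↔ i ∈ A ∩ B) := fun S i hi => by
    rw [Finset.mem_union, or_iff_left]
    intro h
    obtain ⟨s, -, hs⟩ := Finset.mem_image.1 h
    exact hi s hs
  have hbal := abs_card_sublevel_sub_le b c _ _ e he hbe hce hodd heven
    (fun i hi => (hout _ i hi).trans (hout _ i hi).symm)
  refine ⟨?_, ?_, ?_, cost_add_cost_le b c d A B _ _ ?_ ?_ ?_⟩
  · rw [Finset.card_union_of_disjoint (hdisj _), Finset.card_image_of_injective _ he]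
    omega
  · simp only [Finset.card_union_of_disjoint (hdisj _), Finset.card_image_of_injective _ he]
    omega
  · rw [Finset.card_union_of_disjoint (hdisj _), Finset.card_image_of_injective _ he]
    omega
  · intro i
    by_cases hi : ∃ s, e s = i
    · obtain ⟨s, rfl⟩ := hi
      have := hmem s
      rw [hodd, heven]
      rw [Finset.mem_symmDiff] at this
      rcases Nat.mod_two_eq_zero_or_one (s : ℕ) with hs | hs <;> simp only [hs] <;> tauto
    · push Not at hi
      have hi' : i ∉ symmDiff A B := by
        rw [← himg]
        simpa using hi
      rw [hout _ i hi, hout _ i hi, Finset.mem_inter]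
      rw [Finset.mem_symmDiff] at hi'
      tauto
  · intro t
    have := abs_le.1 (hbal t)
    omega
  · intro t
    have := abs_le.1 (hbal t)
    omega
end
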